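/- arXiv:2312.08784 — 2 statements merged into one kernel-verified Lean document; each statement's English description precedes it below -/
import Mathlib

section
/- Let α ∈ (1/2,1), σ > 0, φ(t) = ασ(1+σt)^{-(α+1)}, and for each n ≥ 1 let ζ_n ∈ (0,1) and R_n(t) = ∑_{k=1}^∞ ζ_n^k φ^{*k}(t) be the resolvent of ζ_n φ. Assume n^α(1−ζ_n) → b for some constant b > 0 as n → ∞, and set γ = b σ^α / Γ(1−α). Then sup_{t ≥ 0} | ∫_0^t n^{1−α} R_n(ns) ds − F^{α,γ}(t)/b | → 0 as n → ∞. -/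
open MeasureTheory Real Filter Set

/-- Convolution of two functions on `[0,∞)`: `(f * g)(t) = ∫_0^t f(t-s) g(s) ds`. -/
noncomputable def conv (f g : ℝ → ℝ) : ℝ → ℝ := fun t => ∫ s in (0:ℝ)..t, f (t - s) * g s

/-- Convolution powers: `convPow f k = f^{*(k+1)}`, i.e. `convPow f 0 = f`. -/
noncomputable def convPow (f : ℝ → ℝ) : ℕ → ℝ → ℝ
  | 0 => f
  | (k + 1) => conv f (convPow f k)

/-- The Mittag-Leffler function `E_{a,k}(x) = ∑_{m=0}^∞ x^m / Γ(a m + k)`. -/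
noncomputable def mittagLeffler (a k x : ℝ) : ℝ := ∑' m : ℕ, x ^ m / Real.Gamma (a * m + k)

/-- The Mittag-Leffler distribution function `F^{a,g}(t) = 1 - E_{a,1}(-g t^a)`. -/
noncomputable def mlCDF (a g t : ℝ) : ℝ := 1 - mittagLeffler a 1 (-g * t ^ a)


open scoped ENNReal Topology

namespace RescaledResolvent

/-- Extend a function on `(0,∞)` by zero, as an `ℝ≥0∞`-valued function. -/
noncomputable def up (F : ℝ → ℝ) : ℝ → ℝ≥0∞ :=
  (Set.Ioi (0:ℝ)).indicator (fun t => ENNReal.ofReal (F t))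

lemma up_pos (F : ℝ → ℝ) {t : ℝ} (ht : 0 < t) : up F t = ENNReal.ofReal (F t) := by
  simp [up, ht]

lemma up_nonpos (F : ℝ → ℝ) {t : ℝ} (ht : t ≤ 0) : up F t = 0 := by
  simp [up, ht]

lemma measurable_up {F : ℝ → ℝ} (hF : Measurable F) : Measurable (up F) := by
  unfold up
  exact (ENNReal.measurable_ofReal.comp hF).indicator measurableSet_Ioi

lemma lconv_add (f g h : ℝ → ℝ≥0∞) (hf : Measurable f) (hg : Measurable g) :
    f ⋆ₗ (g + h) = f ⋆ₗ g + f ⋆ₗ h := by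
  ext x
  simp only [lconvolution_def, Pi.add_apply, mul_add]
  rw [lintegral_add_left (by fun_prop)]

lemma lconv_smul (c : ℝ≥0∞) (f g : ℝ → ℝ≥0∞) (hf : Measurable f) (hg : Measurable g) :
    f ⋆ₗ (c • g) = c • (f ⋆ₗ g) := by
  ext x
  simp only [lconvolution_def, Pi.smul_apply, smul_eq_mul]
  rw [← lintegral_const_mul _ (by fun_prop)]
  congr 1; ext y; ring

lemma lconv_tsum (f : ℝ → ℝ≥0∞) (g : ℕ → ℝ → ℝ≥0∞) (hf : Measurable f)
    (hg : ∀ k, Measurable (g k)) :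
    f ⋆ₗ (fun t => ∑' k, g k t) = fun t => ∑' k, (f ⋆ₗ (g k)) t := by
  ext x
  simp only [lconvolution_def, ← ENNReal.tsum_mul_left]
  rw [lintegral_tsum]
  intro k
  have := hg k
  fun_prop

lemma lconv_mono {f g h : ℝ → ℝ≥0∞} (hgh : ∀ x, g x ≤ h x) (x : ℝ) :
    (f ⋆ₗ g) x ≤ (f ⋆ₗ h) x := by
  simp only [lconvolution_def]
  exact lintegral_mono fun y => by gcongr; apply hgh

/-- Exponentially weighted `L¹` norm. -/
noncomputable def wN (s : ℝ) (f : ℝ → ℝ≥0∞) : ℝ≥0∞ :=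
  ∫⁻ x, ENNReal.ofReal (Real.exp (-s * x)) * f x

lemma wN_lconv (s : ℝ) (f g : ℝ → ℝ≥0∞) (hf : Measurable f) (hg : Measurable g) :
    wN s (f ⋆ₗ g) = wN s f * wN s g := by
  unfold wN
  simp only [lconvolution_def]
  have h1 : ∀ x, ENNReal.ofReal (Real.exp (-s * x)) * ∫⁻ y, f y * g (-y + x)
      = ∫⁻ y, (ENNReal.ofReal (Real.exp (-s * y)) * f y) *
        (ENNReal.ofReal (Real.exp (-s * (-y + x))) * g (-y + x)) := by
    intro x
    rw [← lintegral_const_mul _ (by fun_prop)]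
    congr 1; ext y
    rw [show -s * x = -s * y + -s * (-y + x) by ring, Real.exp_add,
      ENNReal.ofReal_mul (Real.exp_pos _).le]
    ring
  simp_rw [h1]
  rw [lintegral_lintegral_swap (by fun_prop)]
  have h2 : ∀ y, ∫⁻ x, (ENNReal.ofReal (Real.exp (-s * y)) * f y) *
        (ENNReal.ofReal (Real.exp (-s * (-y + x))) * g (-y + x)) =
      (ENNReal.ofReal (Real.exp (-s * y)) * f y) * ∫⁻ x, ENNReal.ofReal (Real.exp (-s * x)) * g x := by
    intro y
    rw [lintegral_const_mul _ (by fun_prop)]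
    congr 1
    exact lintegral_add_left_eq_self (fun x => ENNReal.ofReal (Real.exp (-s * x)) * g x) (-y)
  simp_rw [h2]
  rw [lintegral_mul_const _ (by fun_prop)]

lemma wN_mono (s : ℝ) {f g : ℝ → ℝ≥0∞} (h : ∀ x, f x ≤ g x) : wN s f ≤ wN s g :=
  lintegral_mono fun x => by gcongr; exact h x

lemma wN_add (s : ℝ) (f g : ℝ → ℝ≥0∞) (hf : Measurable f) :
    wN s (f + g) = wN s f + wN s g := by
  unfold wN
  simp only [Pi.add_apply, mul_add]
  rw [lintegral_add_left (by fun_prop)]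

lemma wN_smul (s : ℝ) (c : ℝ≥0∞) (f : ℝ → ℝ≥0∞) (hf : Measurable f) :
    wN s (c • f) = c * wN s f := by
  unfold wN
  rw [← lintegral_const_mul _ (by fun_prop)]
  congr 1; ext y; simp only [Pi.smul_apply, smul_eq_mul]; ring

lemma wN_zero (f : ℝ → ℝ≥0∞) : wN 0 f = ∫⁻ x, f x := by
  simp [wN]

lemma wN_le_lintegral {s : ℝ} (hs : 0 ≤ s) (f : ℝ → ℝ≥0∞) (hf : ∀ x ≤ 0, f x = 0) :
    wN s f ≤ ∫⁻ x, f x := by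
  unfold wN
  refine lintegral_mono fun x => ?_
  rcases le_or_gt x 0 with hx | hx
  · simp [hf x hx]
  · calc _ ≤ 1 * f x := by
          gcongr
          rw [ENNReal.ofReal_le_one, Real.exp_le_one_iff]
          nlinarith
      _ = _ := one_mul _

lemma lintegral_lconv (f g : ℝ → ℝ≥0∞) (hf : Measurable f) (hg : Measurable g) :
    ∫⁻ x, (f ⋆ₗ g) x = (∫⁻ x, f x) * ∫⁻ x, g x := by
  rw [← wN_zero, ← wN_zero, ← wN_zero, wN_lconv 0 f g hf hg]

/-- convolution of functions supported on `(0,∞)` -/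
lemma lconv_pos (f g : ℝ → ℝ≥0∞) (hf : ∀ x ≤ 0, f x = 0) (hg : ∀ x ≤ 0, g x = 0) (t : ℝ) :
    (f ⋆ₗ g) t = ∫⁻ y in Set.Ioo 0 t, f y * g (t - y) := by
  rw [lconvolution_def, ← lintegral_indicator measurableSet_Ioo]
  congr 1; ext y
  by_cases hy : y ∈ Set.Ioo 0 t
  · simp only [Set.indicator_of_mem hy]; congr 2; ring
  · rw [Set.indicator_of_notMem hy]
    rcases le_or_gt y 0 with h | h
    · simp [hf y h]
    · have : t ≤ y := by
        by_contra hc; exact hy ⟨h, by linarith⟩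
      rw [hg (-y + t) (by linarith), mul_zero]

lemma lconv_nonpos (f g : ℝ → ℝ≥0∞) (hf : ∀ x ≤ 0, f x = 0) (hg : ∀ x ≤ 0, g x = 0)
    {t : ℝ} (ht : t ≤ 0) : (f ⋆ₗ g) t = 0 := by
  rw [lconv_pos f g hf hg, Set.Ioo_eq_empty (by linarith)]; simp

lemma lconv_up (F G : ℝ → ℝ) (hF : ∀ x, 0 < x → 0 ≤ F x) (t : ℝ) :
    (up F ⋆ₗ up G) t = ∫⁻ y in Set.Ioo 0 t, ENNReal.ofReal (F y * G (t - y)) := by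
  rw [lconv_pos _ _ (fun x hx => up_nonpos F hx) (fun x hx => up_nonpos G hx)]
  refine setLIntegral_congr_fun measurableSet_Ioo fun y hy => ?_
  rw [up_pos F hy.1, up_pos G (by linarith [hy.2]), ENNReal.ofReal_mul (hF y hy.1)]

lemma beta_real {a c t : ℝ} (ha : 0 < a) (hc : 0 < c) (ht : 0 < t) :
    ∫ y in (0:ℝ)..t, y ^ (a - 1) * (t - y) ^ (c - 1) =
      t ^ (a + c - 1) * (Real.Gamma a * Real.Gamma c / Real.Gamma (a + c)) := by
  have h := Complex.betaIntegral_scaled (a:ℂ) (c:ℂ) ht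
  rw [Complex.betaIntegral_eq_Gamma_mul_div _ _ (by simpa) (by simpa)] at h
  have h2 : (∫ x : ℝ in (0:ℝ)..t, (x : ℂ) ^ ((a:ℂ) - 1) * ((t:ℂ) - x) ^ ((c:ℂ) - 1)) =
      ((∫ y in (0:ℝ)..t, y ^ (a - 1) * (t - y) ^ (c - 1) : ℝ) : ℂ) := by
    rw [← intervalIntegral.integral_ofReal]
    refine intervalIntegral.integral_congr fun y hy => ?_
    rw [Set.uIcc_of_le ht.le] at hy
    push_cast
    rw [Complex.ofReal_cpow hy.1, Complex.ofReal_cpow (by linarith [hy.2])]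
    push_cast; rfl
  rw [h2] at h
  have h3 : ((t:ℂ) ^ ((a:ℂ) + c - 1)) = ((t ^ (a + c - 1) : ℝ) : ℂ) := by
    rw [Complex.ofReal_cpow ht.le]; push_cast; rfl
  rw [h3, ← Complex.ofReal_add, Complex.Gamma_ofReal, Complex.Gamma_ofReal, Complex.Gamma_ofReal] at h
  exact_mod_cast h

lemma beta_real_pos {a c t : ℝ} (ha : 0 < a) (hc : 0 < c) (ht : 0 < t) :
    0 < ∫ y in (0:ℝ)..t, y ^ (a - 1) * (t - y) ^ (c - 1) := by
  rw [beta_real ha hc ht]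
  have := Real.Gamma_pos_of_pos ha
  have := Real.Gamma_pos_of_pos hc
  have := Real.Gamma_pos_of_pos (add_pos ha hc)
  positivity

lemma beta_integrable {a c t : ℝ} (ha : 0 < a) (hc : 0 < c) (ht : 0 < t) :
    IntervalIntegrable (fun y => y ^ (a - 1) * (t - y) ^ (c - 1)) volume 0 t :=
  intervalIntegral.intervalIntegrable_of_integral_ne_zero (beta_real_pos ha hc ht).ne'

lemma lint_Ioo_ofReal {F : ℝ → ℝ} {t : ℝ} (ht : 0 ≤ t) (hi : IntervalIntegrable F volume 0 t)
    (h0 : ∀ y, 0 < y → y < t → 0 ≤ F y) :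
    ∫⁻ y in Set.Ioo 0 t, ENNReal.ofReal (F y) = ENNReal.ofReal (∫ y in (0:ℝ)..t, F y) := by
  rw [intervalIntegral.integral_of_le ht, integral_Ioc_eq_integral_Ioo,
    ofReal_integral_eq_lintegral_ofReal]
  · exact ((intervalIntegrable_iff_integrableOn_Ioo_of_le ht).1 hi)
  · exact (ae_restrict_iff' measurableSet_Ioo).2 (Eventually.of_forall fun y hy => h0 y hy.1 hy.2)

/-! ### the Mittag-Leffler function -/

lemma gamma_lower {s A : ℝ} (hs : 0 ≤ s) (hA : 0 ≤ A) :
    A ^ s * Real.exp (-A) ≤ Real.Gamma (s + 1) := by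
  rw [Real.Gamma_eq_integral (by linarith)]
  have hint := Real.GammaIntegral_convergent (s := s + 1) (by linarith)
  calc A ^ s * Real.exp (-A) = ∫ x in Set.Ioi A, Real.exp (-x) * A ^ s := by
        rw [integral_mul_const, integral_exp_neg_Ioi]; ring
    _ ≤ ∫ x in Set.Ioi A, Real.exp (-x) * x ^ (s + 1 - 1) := by
        apply setIntegral_mono_on
        · exact (integrableOn_exp_neg_Ioi A).mul_const _
        · exact hint.mono_set (Set.Ioi_subset_Ioi hA)
        · exact measurableSet_Ioi
        · intro x hx
          rw [add_sub_cancel_right]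
          have : A < x := hx
          gcongr
    _ ≤ _ := by
        apply setIntegral_mono_set hint
        · refine (ae_restrict_iff' measurableSet_Ioi).2 (Eventually.of_forall fun y hy => ?_)
          have : (0:ℝ) < y := hy
          simp only [Pi.zero_apply]; positivity
        · exact (Set.Ioi_subset_Ioi hA).eventuallyLE

lemma ml_term {α x : ℝ} (hα : 0 < α) (m : ℕ) :
    |x ^ m / Real.Gamma (α * m + 1)| ≤ Real.exp ((2 * |x|) ^ (1 / α)) * (1 / 2) ^ m := by
  set A := (2 * |x|) ^ (1 / α) with hA
  have hA0 : 0 ≤ A := by positivity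
  have hm : (0:ℝ) ≤ α * m := by positivity
  have hG := gamma_lower hm hA0
  have hGp : 0 < Real.Gamma (α * m + 1) := Real.Gamma_pos_of_pos (by linarith)
  have hAm : A ^ (α * m) = (2 * |x|) ^ m := by
    rw [hA, ← Real.rpow_mul (by positivity), ← Real.rpow_natCast]
    congr 1; field_simp
  rw [hAm] at hG
  rw [abs_div, abs_of_pos hGp, div_le_iff₀ hGp, abs_pow]
  calc |x| ^ m = Real.exp A * (1 / 2) ^ m * ((2 * |x|) ^ m * Real.exp (-A)) := by
        rw [mul_pow, Real.exp_neg, one_div, inv_pow]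
        field_simp
    _ ≤ _ := by gcongr

lemma ml_summable {α : ℝ} (hα : 0 < α) (x : ℝ) :
    Summable (fun m : ℕ => x ^ m / Real.Gamma (α * m + 1)) := by
  refine Summable.of_norm_bounded (g := fun m : ℕ => Real.exp ((2 * |x|) ^ (1 / α)) * (1 / 2) ^ m)
    (summable_geometric_two.mul_left _) fun m => ?_
  rw [Real.norm_eq_abs]; exact ml_term hα m

lemma ml_bound {α : ℝ} (hα : 0 < α) (x : ℝ) :
    |mittagLeffler α 1 x| ≤ 2 * Real.exp ((2 * |x|) ^ (1 / α)) := by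
  unfold mittagLeffler
  have := tsum_of_norm_bounded (f := fun m : ℕ => x ^ m / Real.Gamma (α * m + 1))
    (summable_geometric_two.hasSum.mul_left (Real.exp ((2 * |x|) ^ (1 / α))))
    (fun m => by rw [Real.norm_eq_abs]; exact ml_term hα m)
  rw [Real.norm_eq_abs] at this
  rw [tsum_geometric_two] at this
  linarith

lemma ml_continuous {α : ℝ} (hα : 0 < α) : Continuous (mittagLeffler α 1) := by
  rw [continuous_iff_continuousAt]
  intro x
  have h : ContinuousOn (fun y => ∑' m : ℕ, y ^ m / Real.Gamma (α * m + 1))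
      (Set.Icc (-(|x| + 1)) (|x| + 1)) := by
    refine continuousOn_tsum
      (u := fun m : ℕ => Real.exp ((2 * (|x| + 1)) ^ (1 / α)) * (1 / 2) ^ m) ?_ ?_ ?_
    · intro m; fun_prop
    · exact (summable_geometric_two.mul_left _)
    · intro m y hy
      rw [Real.norm_eq_abs]
      refine (ml_term hα m).trans ?_
      have : |y| ≤ |x| + 1 := abs_le.2 hy
      gcongr
  refine h.continuousAt (Icc_mem_nhds ?_ ?_)
  · linarith [neg_abs_le x]
  · linarith [le_abs_self x]

lemma ml_zero (α : ℝ) : mittagLeffler α 1 0 = 1 := by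
  unfold mittagLeffler
  rw [tsum_eq_single 0]
  · simp
  · intro m hm; simp [hm]

/-- `1 - E(-γ t^α) = γ/Γ(α) ∫_0^t (t-s)^{α-1} E(-γ s^α) ds` -/
lemma ml_volterra {α γ t : ℝ} (hα : 0 < α) (hγ : 0 < γ) (ht : 0 < t) :
    ∫ y in (0:ℝ)..t, (y ^ (α - 1)) * mittagLeffler α 1 (-γ * (t - y) ^ α) =
     (Real.Gamma α / γ) * (1 - mittagLeffler α 1 (-γ * t ^ α)) := by
  have hGα := Real.Gamma_pos_of_pos hα
  have hs := ml_summable hα (-γ * t ^ α)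
  -- termwise
  have hterm : ∀ m : ℕ, ∫ y in (0:ℝ)..t,
      y ^ (α - 1) * ((-γ * (t - y) ^ α) ^ m / Real.Gamma (α * m + 1)) =
      -(Real.Gamma α / γ) * ((-γ * t ^ α) ^ (m + 1) / Real.Gamma (α * (m + 1 : ℕ) + 1)) := by
    intro m
    have hG : 0 < Real.Gamma (α * m + 1) := Real.Gamma_pos_of_pos (by positivity)
    have e : ∫ y in (0:ℝ)..t,
      y ^ (α - 1) * ((-γ * (t - y) ^ α) ^ m / Real.Gamma (α * m + 1)) =
      ∫ y in (0:ℝ)..t, ((-γ) ^ m / Real.Gamma (α * m + 1)) *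
        (y ^ (α - 1) * (t - y) ^ ((α * m + 1) - 1)) := by
      refine intervalIntegral.integral_congr fun y hy => ?_
      rw [Set.uIcc_of_le ht.le] at hy
      rw [add_sub_cancel_right, Real.rpow_mul_natCast (by linarith [hy.2]), mul_pow]
      ring
    rw [e, intervalIntegral.integral_const_mul, beta_real hα (by positivity) ht]
    have e2 : t ^ (α + (α * m + 1) - 1) = (t ^ α) ^ (m + 1) := by
      rw [← Real.rpow_mul_natCast ht.le]; congr 1; push_cast; ring
    rw [e2, show α * ((m + 1 : ℕ) : ℝ) + 1 = α + (α * m + 1) by push_cast; ring]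
    have : 0 < Real.Gamma (α + (α * m + 1)) := Real.Gamma_pos_of_pos (by positivity)
    field_simp
    ring
  have hC := ml_term (x := -γ * t ^ α) hα
  set C := Real.exp ((2 * |-γ * t ^ α|) ^ (1 / α)) with hCdef
  have hsum := intervalIntegral.hasSum_integral_of_dominated_convergence
    (μ := volume) (a := 0) (b := t)
    (F := fun (m : ℕ) y => y ^ (α - 1) * ((-γ * (t - y) ^ α) ^ m / Real.Gamma (α * m + 1)))
    (f := fun y => y ^ (α - 1) * mittagLeffler α 1 (-γ * (t - y) ^ α))
    (fun m y => y ^ (α - 1) * (C * (1 / 2) ^ m)) ?_ ?_ ?_ ?_ ?_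
  · rw [← hsum.tsum_eq]
    simp_rw [hterm]
    rw [tsum_mul_left]
    have := hs.tsum_eq_zero_add
    unfold mittagLeffler
    rw [this]
    simp
  · intro m
    apply Measurable.aestronglyMeasurable
    fun_prop
  · intro m
    refine Eventually.of_forall fun y hy => ?_
    rw [Set.uIoc_of_le ht.le] at hy
    have h0 : 0 ≤ y := hy.1.le
    have h1 : 0 ≤ t - y := by linarith [hy.2]
    rw [norm_mul, Real.norm_of_nonneg (by positivity), Real.norm_eq_abs]
    gcongr
    refine (ml_term hα m).trans ?_
    rw [hCdef, abs_mul, abs_mul]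
    gcongr
    · linarith
  · refine Eventually.of_forall fun y hy => ?_
    exact (summable_geometric_two.mul_left _).mul_left _
  · simp_rw [tsum_mul_left]
    exact (intervalIntegral.intervalIntegrable_rpow' (by linarith)).mul_const _
  · refine Eventually.of_forall fun y hy => ?_
    exact (ml_summable hα _).hasSum.mul_left _


/-! ### kernels and the resolvent -/

noncomputable def phiR (α σ : ℝ) : ℝ → ℝ := fun t => α * σ * (1 + σ * t) ^ (-(α + 1))
noncomputable def PR (α σ : ℝ) : ℝ → ℝ := fun t => (1 + σ * t) ^ (-α)
noncomputable def KR (α σ : ℝ) : ℝ → ℝ := fun t => (σ * t) ^ (-α)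
noncomputable def QR (α σ : ℝ) : ℝ → ℝ := fun t => KR α σ t - PR α σ t
noncomputable def kap (α σ : ℝ) : ℝ := σ ^ α / Real.Gamma (1 - α)
noncomputable def JR (α σ : ℝ) : ℝ → ℝ := fun t => kap α σ / Real.Gamma α * t ^ (α - 1)
noncomputable def HR : ℝ → ℝ := fun _ => 1

noncomputable def fk (α σ : ℝ) : ℕ → ℝ → ℝ≥0∞
  | 0 => up (phiR α σ)
  | (k + 1) => up (phiR α σ) ⋆ₗ fk α σ k

noncomputable def res (α σ ζ : ℝ) : ℝ → ℝ≥0∞ :=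
  fun t => ∑' k : ℕ, ENNReal.ofReal ζ ^ (k + 1) * fk α σ k t

noncomputable def Wf (α σ ζ : ℝ) : ℝ → ℝ≥0∞ := up HR ⋆ₗ res α σ ζ

lemma measurable_phi (α σ : ℝ) : Measurable (up (phiR α σ)) :=
  measurable_up (by unfold phiR; fun_prop)
lemma measurable_P (α σ : ℝ) : Measurable (up (PR α σ)) :=
  measurable_up (by unfold PR; fun_prop)
lemma measurable_K (α σ : ℝ) : Measurable (up (KR α σ)) :=
  measurable_up (by unfold KR; fun_prop)
lemma measurable_Q (α σ : ℝ) : Measurable (up (QR α σ)) :=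
  measurable_up (by unfold QR KR PR; fun_prop)
lemma measurable_J (α σ : ℝ) : Measurable (up (JR α σ)) :=
  measurable_up (by unfold JR; fun_prop)
lemma measurable_H : Measurable (up HR) :=
  measurable_up (by unfold HR; fun_prop)

lemma measurable_fk (α σ : ℝ) (k : ℕ) : Measurable (fk α σ k) := by
  induction k with
  | zero => exact measurable_phi α σ
  | succ k ih => exact measurable_lconvolution _ (measurable_phi α σ) ih

lemma measurable_res (α σ ζ : ℝ) : Measurable (res α σ ζ) := by
  unfold res
  exact Measurable.tsum fun k => (measurable_fk α σ k).const_mul _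

lemma measurable_W (α σ ζ : ℝ) : Measurable (Wf α σ ζ) :=
  measurable_lconvolution _ measurable_H (measurable_res α σ ζ)

lemma fk_nonpos (α σ : ℝ) (k : ℕ) : ∀ x ≤ 0, fk α σ k x = 0 := by
  induction k with
  | zero => exact fun x hx => up_nonpos _ hx
  | succ k ih => exact fun x hx => lconv_nonpos _ _ (fun x hx => up_nonpos _ hx) ih hx

lemma res_nonpos (α σ ζ : ℝ) : ∀ x ≤ 0, res α σ ζ x = 0 := by
  intro x hx
  simp [res, fk_nonpos α σ _ x hx]

lemma PR_hasDeriv {α σ t : ℝ} (hσ : 0 < σ) (ht : 0 ≤ t) :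
    HasDerivAt (fun s => -PR α σ s) (phiR α σ t) t := by
  unfold PR phiR
  have h1 : HasDerivAt (fun s : ℝ => 1 + σ * s) σ t := by
    simpa using ((hasDerivAt_id t).const_mul σ).const_add 1
  have hp : 0 < 1 + σ * t := by positivity
  have h2 := (h1.rpow_const (p := -α) (Or.inl hp.ne')).neg
  have e : α * σ * (1 + σ * t) ^ (-(α + 1)) = -(σ * -α * (1 + σ * t) ^ (-α - 1)) := by
    rw [show -(α + 1) = -α - 1 by ring]
    ring
  rw [e]
  exact h2

lemma phiR_nonneg {α σ t : ℝ} (hα : 0 < α) (hσ : 0 < σ) (ht : 0 ≤ t) : 0 ≤ phiR α σ t := by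
  unfold phiR; positivity

lemma phiR_le {α σ t : ℝ} (hα : 0 < α) (hσ : 0 < σ) (ht : 0 ≤ t) : phiR α σ t ≤ α * σ := by
  unfold phiR
  have : (1 + σ * t) ^ (-(α + 1)) ≤ 1 :=
    Real.rpow_le_one_of_one_le_of_nonpos (by nlinarith) (by linarith)
  have h : 0 < α * σ := by positivity
  nlinarith

lemma phi_continuousOn {α σ t : ℝ} (hσ : 0 < σ) :
    ContinuousOn (phiR α σ) (Set.Icc 0 t) := by
  unfold phiR
  refine ContinuousOn.mul continuousOn_const (ContinuousOn.rpow_const (by fun_prop) ?_)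
  intro x hx
  have := hx.1
  left; positivity

lemma phi_integral {α σ t : ℝ} (hσ : 0 < σ) (ht : 0 ≤ t) :
    ∫ y in (0:ℝ)..t, phiR α σ y = 1 - PR α σ t := by
  rw [intervalIntegral.integral_eq_sub_of_hasDerivAt (f := fun s => -PR α σ s)]
  · simp [PR]; ring
  · intro x hx
    rw [Set.uIcc_of_le ht] at hx
    exact PR_hasDeriv hσ hx.1
  · apply ContinuousOn.intervalIntegrable
    rw [Set.uIcc_of_le ht]
    exact phi_continuousOn hσ

lemma PR_nonneg {α σ t : ℝ} (hσ : 0 < σ) (ht : 0 ≤ t) : 0 ≤ PR α σ t := by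
  unfold PR; positivity

lemma PR_le_one {α σ t : ℝ} (hα : 0 < α) (hσ : 0 < σ) (ht : 0 ≤ t) : PR α σ t ≤ 1 := by
  unfold PR
  exact Real.rpow_le_one_of_one_le_of_nonpos (by nlinarith) (by linarith)

lemma P_add {α σ : ℝ} (hα : 0 < α) (hσ : 0 < σ) :
    up (PR α σ) + up (phiR α σ) ⋆ₗ up HR = up HR := by
  ext t
  rcases le_or_gt t 0 with ht | ht
  · rw [Pi.add_apply, up_nonpos _ ht, up_nonpos _ ht, lconv_nonpos _ _ (fun x hx => up_nonpos _ hx)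
      (fun x hx => up_nonpos _ hx) ht, add_zero]
  · rw [Pi.add_apply, lconv_up _ _ (fun x hx => phiR_nonneg hα hσ hx.le), up_pos _ ht, up_pos _ ht]
    simp only [HR, mul_one]
    rw [lint_Ioo_ofReal ht.le, phi_integral hσ ht.le, ← ENNReal.ofReal_add]
    · congr 1; ring
    · exact PR_nonneg hσ ht.le
    · linarith [PR_le_one hα hσ ht.le]
    · apply ContinuousOn.intervalIntegrable
      rw [Set.uIcc_of_le ht.le]
      exact phi_continuousOn hσ
    · intro y hy _; exact phiR_nonneg hα hσ hy.le

lemma lint_phi {α σ : ℝ} (hα : 0 < α) (hσ : 0 < σ) : ∫⁻ x, up (phiR α σ) x ≤ 1 := by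
  have hlim : Tendsto (fun s => -PR α σ s) atTop (𝓝 0) := by
    rw [← neg_zero]
    refine Tendsto.neg ?_
    unfold PR
    refine (tendsto_rpow_neg_atTop hα).comp ?_
    exact tendsto_atTop_add_const_left _ _ (tendsto_id.const_mul_atTop hσ)
  have hd : ∀ x ∈ Set.Ici (0:ℝ), HasDerivAt (fun s => -PR α σ s) (phiR α σ x) x :=
    fun x hx => PR_hasDeriv hσ hx
  have hn : ∀ x ∈ Set.Ioi (0:ℝ), 0 ≤ phiR α σ x :=
    fun x hx => phiR_nonneg hα hσ (le_of_lt hx)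
  have hi := integrableOn_Ioi_deriv_of_nonneg' hd hn hlim
  have he := integral_Ioi_of_hasDerivAt_of_nonneg' hd hn hlim
  unfold up
  rw [lintegral_indicator measurableSet_Ioi, ← ofReal_integral_eq_lintegral_ofReal hi
    ((ae_restrict_iff' measurableSet_Ioi).2 (Eventually.of_forall hn)), he]
  simp [PR]

lemma lint_fk {α σ : ℝ} (hα : 0 < α) (hσ : 0 < σ) (k : ℕ) : ∫⁻ x, fk α σ k x ≤ 1 := by
  induction k with
  | zero => exact lint_phi hα hσ
  | succ k ih =>
    simp only [fk]
    rw [lintegral_lconv _ _ (measurable_phi α σ) (measurable_fk α σ k)]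
    exact mul_le_one' (lint_phi hα hσ) ih

lemma fk_le {α σ : ℝ} (hα : 0 < α) (hσ : 0 < σ) (k : ℕ) (t : ℝ) :
    fk α σ k t ≤ ENNReal.ofReal (α * σ) := by
  have h0 : ∀ t, up (phiR α σ) t ≤ ENNReal.ofReal (α * σ) := by
    intro t
    rcases le_or_gt t 0 with ht | ht
    · simp [up_nonpos _ ht]
    · rw [up_pos _ ht]; exact ENNReal.ofReal_le_ofReal (phiR_le hα hσ ht.le)
  cases k with
  | zero => exact h0 t
  | succ k =>
    simp only [fk]
    rw [lconvolution_comm, lconvolution_def]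
    calc _ ≤ ∫⁻ y, fk α σ k y * ENNReal.ofReal (α * σ) :=
          lintegral_mono fun y => by gcongr; exact h0 _
      _ = (∫⁻ y, fk α σ k y) * ENNReal.ofReal (α * σ) := lintegral_mul_const _ (measurable_fk α σ k)
      _ ≤ 1 * ENNReal.ofReal (α * σ) := by gcongr; exact lint_fk hα hσ k
      _ = _ := one_mul _

lemma convPow_eq {α σ : ℝ} (hα : 0 < α) (hσ : 0 < σ) (k : ℕ) :
    ∀ t, 0 < t → convPow (phiR α σ) k t = (fk α σ k t).toReal := by
  induction k with
  | zero =>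
    intro t ht
    simp only [convPow, fk]
    rw [up_pos _ ht, ENNReal.toReal_ofReal (phiR_nonneg hα hσ ht.le)]
  | succ k ih =>
    intro t ht
    simp only [convPow, fk, conv]
    rw [lconvolution_comm, lconv_pos _ _ (fk_nonpos α σ k) (fun x hx => up_nonpos _ hx),
      intervalIntegral.integral_of_le ht.le, integral_Ioc_eq_integral_Ioo, ← integral_toReal]
    · refine setIntegral_congr_fun measurableSet_Ioo fun s hs => ?_
      rw [ih s hs.1, up_pos _ (by linarith [hs.2]), ENNReal.toReal_mul,
        ENNReal.toReal_ofReal (phiR_nonneg hα hσ (by linarith [hs.2])), mul_comm]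
    · have := measurable_fk α σ k
      have := measurable_phi α σ
      apply Measurable.aemeasurable
      fun_prop
    · refine Eventually.of_forall fun y => ?_
      refine ENNReal.mul_lt_top ((fk_le hα hσ k y).trans_lt ENNReal.ofReal_lt_top) ?_
      exact (fk_le hα hσ 0 (t - y)).trans_lt ENNReal.ofReal_lt_top

lemma res_toReal {α σ ζ : ℝ} (hα : 0 < α) (hσ : 0 < σ) (hζ : 0 < ζ) {t : ℝ} (ht : 0 < t) :
    ∑' k : ℕ, ζ ^ (k + 1) * convPow (phiR α σ) k t = (res α σ ζ t).toReal := by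
  unfold res
  rw [ENNReal.tsum_toReal_eq]
  · congr 1; ext k
    rw [convPow_eq hα hσ k t ht, ENNReal.toReal_mul, ENNReal.toReal_pow,
      ENNReal.toReal_ofReal hζ.le]
  · intro k
    exact ENNReal.mul_ne_top (ENNReal.pow_ne_top ENNReal.ofReal_ne_top)
      ((fk_le hα hσ k t).trans_lt ENNReal.ofReal_lt_top).ne

lemma lint_res {α σ ζ : ℝ} (hα : 0 < α) (hσ : 0 < σ) (hζ : 0 < ζ) (hζ1 : ζ < 1) :
    ∫⁻ x, res α σ ζ x ≤ ENNReal.ofReal (ζ / (1 - ζ)) := by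
  unfold res
  rw [lintegral_tsum (fun k => ((measurable_fk α σ k).const_mul _).aemeasurable)]
  calc _ ≤ ∑' k : ℕ, ENNReal.ofReal ζ ^ (k + 1) := by
        refine ENNReal.tsum_le_tsum fun k => ?_
        rw [lintegral_const_mul _ (measurable_fk α σ k)]
        calc _ ≤ ENNReal.ofReal ζ ^ (k + 1) * 1 := by gcongr; exact lint_fk hα hσ k
          _ = _ := mul_one _
    _ = ENNReal.ofReal (∑' k : ℕ, ζ ^ (k + 1)) := by
        rw [ENNReal.ofReal_tsum_of_nonneg]
        · congr 1; ext k; rw [ENNReal.ofReal_pow hζ.le]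
        · intro k; positivity
        · simp_rw [pow_succ]
          exact (summable_geometric_of_lt_one hζ.le hζ1).mul_right _
    _ = _ := by
        congr 1
        simp_rw [pow_succ]
        rw [tsum_mul_right, tsum_geometric_of_lt_one hζ.le hζ1]
        ring

lemma res_eq (α σ ζ : ℝ) :
    res α σ ζ = ENNReal.ofReal ζ • up (phiR α σ) +
      ENNReal.ofReal ζ • (up (phiR α σ) ⋆ₗ res α σ ζ) := by
  have h := lconv_tsum (up (phiR α σ)) (fun k => ENNReal.ofReal ζ ^ (k + 1) • fk α σ k)
    (measurable_phi α σ) (fun k => (measurable_fk α σ k).const_smul _)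
  have e : (fun t => ∑' k : ℕ, (ENNReal.ofReal ζ ^ (k + 1) • fk α σ k) t) = res α σ ζ := rfl
  rw [e] at h
  rw [h]
  ext t
  simp only [Pi.add_apply, Pi.smul_apply, smul_eq_mul]
  conv_lhs => unfold res
  rw [tsum_eq_zero_add' ENNReal.summable]
  congr 1
  · simp [fk]
  · rw [← ENNReal.tsum_mul_left]
    congr 1; ext k
    rw [lconv_smul _ _ _ (measurable_phi α σ) (measurable_fk α σ k)]
    simp only [fk, Pi.smul_apply, smul_eq_mul]
    ring

lemma W_le {α σ ζ : ℝ} (hα : 0 < α) (hσ : 0 < σ) (hζ : 0 < ζ) (hζ1 : ζ < 1) (t : ℝ) :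
    Wf α σ ζ t ≤ ENNReal.ofReal (ζ / (1 - ζ)) := by
  refine le_trans ?_ (lint_res hα hσ hζ hζ1)
  unfold Wf
  rw [lconvolution_comm, lconvolution_def]
  refine lintegral_mono fun y => ?_
  calc _ ≤ res α σ ζ y * 1 := by
        gcongr
        rcases le_or_gt (-y + t) 0 with h | h
        · simp [up_nonpos _ h]
        · simp [up_pos _ h, HR]
    _ = _ := mul_one _

lemma W_eq_lint (α σ ζ : ℝ) (t : ℝ) :
    Wf α σ ζ t = ∫⁻ y in Set.Ioo 0 t, res α σ ζ y := by
  unfold Wf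
  rw [lconvolution_comm, lconv_pos _ _ (res_nonpos α σ ζ) (fun x hx => up_nonpos _ hx)]
  refine setLIntegral_congr_fun measurableSet_Ioo fun y hy => ?_
  rw [up_pos _ (by linarith [hy.2])]
  simp [HR]

lemma W_nonpos (α σ ζ : ℝ) : ∀ x ≤ 0, Wf α σ ζ x = 0 := by
  intro x hx
  exact lconv_nonpos _ _ (fun x hx => up_nonpos _ hx) (res_nonpos α σ ζ) hx

lemma W_mono (α σ ζ : ℝ) : Monotone (Wf α σ ζ) := by
  intro s t hst
  rw [W_eq_lint, W_eq_lint]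
  exact lintegral_mono_set (Set.Ioo_subset_Ioo_right hst)

lemma W_toReal {α σ ζ : ℝ} (hα : 0 < α) (hσ : 0 < σ) (hζ : 0 < ζ) (hζ1 : ζ < 1) {t : ℝ}
    (ht : 0 ≤ t) :
    ∫ y in (0:ℝ)..t, ∑' k : ℕ, ζ ^ (k + 1) * convPow (phiR α σ) k y = (Wf α σ ζ t).toReal := by
  rw [W_eq_lint, intervalIntegral.integral_of_le ht, integral_Ioc_eq_integral_Ioo,
    ← integral_toReal (measurable_res α σ ζ).aemeasurable]
  · exact setIntegral_congr_fun measurableSet_Ioo fun y hy => res_toReal hα hσ hζ hy.1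
  · apply ae_restrict_of_ae
    exact ae_lt_top (measurable_res α σ ζ)
      ((lint_res hα hσ hζ hζ1).trans_lt ENNReal.ofReal_lt_top).ne

lemma kap_pos {α σ : ℝ} (hα1 : α < 1) (hσ : 0 < σ) : 0 < kap α σ := by
  unfold kap
  have := Real.Gamma_pos_of_pos (show 0 < 1 - α by linarith)
  positivity

lemma JR_nonneg {α σ t : ℝ} (hα : 0 < α) (hα1 : α < 1) (hσ : 0 < σ) (ht : 0 ≤ t) :
    0 ≤ JR α σ t := by
  unfold JR
  have := Real.Gamma_pos_of_pos hα
  have := kap_pos hα1 hσ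
  positivity

lemma KR_nonneg {α σ t : ℝ} (hσ : 0 < σ) (ht : 0 ≤ t) : 0 ≤ KR α σ t := by
  unfold KR; positivity

lemma QR_nonneg {α σ t : ℝ} (hα : 0 < α) (hσ : 0 < σ) (ht : 0 < t) : 0 ≤ QR α σ t := by
  unfold QR KR PR
  have : (1 + σ * t) ^ (-α) ≤ (σ * t) ^ (-α) :=
    Real.rpow_le_rpow_of_nonpos (by positivity) (by linarith) (by linarith)
  linarith

lemma P_add_Q {α σ : ℝ} (hα : 0 < α) (hσ : 0 < σ) :
    up (PR α σ) + up (QR α σ) = up (KR α σ) := by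
  ext t
  rcases le_or_gt t 0 with ht | ht
  · simp [up_nonpos _ ht]
  · rw [Pi.add_apply, up_pos _ ht, up_pos _ ht, up_pos _ ht,
      ← ENNReal.ofReal_add (PR_nonneg hσ ht.le) (QR_nonneg hα hσ ht)]
    simp [QR]

lemma J_conv_K {α σ : ℝ} (hα : 0 < α) (hα1 : α < 1) (hσ : 0 < σ) :
    up (JR α σ) ⋆ₗ up (KR α σ) = up HR := by
  ext t
  rcases le_or_gt t 0 with ht | ht
  · rw [up_nonpos _ ht, lconv_nonpos _ _ (fun x hx => up_nonpos _ hx)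
      (fun x hx => up_nonpos _ hx) ht]
  · have hG := Real.Gamma_pos_of_pos hα
    have hG1 := Real.Gamma_pos_of_pos (show 0 < 1 - α by linarith)
    have hb := beta_real hα (show 0 < 1 - α by linarith) ht
    have hbi := beta_integrable hα (show 0 < 1 - α by linarith) ht
    rw [lconv_up _ _ (fun x hx => JR_nonneg hα hα1 hσ hx.le), up_pos _ ht]
    have e : ∀ y ∈ Set.Ioo 0 t, ENNReal.ofReal (JR α σ y * KR α σ (t - y)) =
        ENNReal.ofReal (1 / (Real.Gamma α * Real.Gamma (1 - α)) *
          (y ^ (α - 1) * (t - y) ^ (1 - α - 1))) := by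
      intro y hy
      congr 1
      unfold JR KR kap
      have : 0 < t - y := by linarith [hy.2]
      rw [Real.mul_rpow hσ.le this.le, show 1 - α - 1 = -α by ring, Real.rpow_neg hσ.le]
      field_simp
    rw [setLIntegral_congr_fun measurableSet_Ioo e, lint_Ioo_ofReal ht.le (hbi.const_mul _),
      intervalIntegral.integral_const_mul, hb]
    · congr 1
      simp [HR]
      field_simp
    · intro y hy hyt
      have : 0 < t - y := by linarith
      positivity

/-- the key identity -/
lemma key_ennreal {α σ ζ : ℝ} (hα : 0 < α) (hα1 : α < 1) (hσ : 0 < σ) :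
    up (JR α σ) ⋆ₗ Wf α σ ζ + ENNReal.ofReal ζ • Wf α σ ζ
        + ENNReal.ofReal ζ • (up (JR α σ) ⋆ₗ up (PR α σ)) =
      ENNReal.ofReal ζ • (up (JR α σ) ⋆ₗ up HR) + ENNReal.ofReal ζ • (up (JR α σ) ⋆ₗ Wf α σ ζ)
        + ENNReal.ofReal ζ • ((up (JR α σ) ⋆ₗ up (QR α σ)) ⋆ₗ res α σ ζ) := by
  set z := ENNReal.ofReal ζ
  set J := up (JR α σ)
  set P := up (PR α σ)
  set Q := up (QR α σ)
  set K := up (KR α σ)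
  set H := up HR
  set f := up (phiR α σ)
  set r := res α σ ζ
  set W := Wf α σ ζ
  have mJ : Measurable J := measurable_J α σ
  have mP : Measurable P := measurable_P α σ
  have mQ : Measurable Q := measurable_Q α σ
  have mH : Measurable H := measurable_H
  have mf : Measurable f := measurable_phi α σ
  have mr : Measurable r := measurable_res α σ ζ
  have mW : Measurable W := measurable_W α σ ζ
  have mPr : Measurable (P ⋆ₗ r) := measurable_lconvolution _ mP mr
  have mfr : Measurable (f ⋆ₗ r) := measurable_lconvolution _ mf mr
  have hW : W = H ⋆ₗ r := rfl
  have hr : r = z • f + z • (f ⋆ₗ r) := res_eq α σ ζ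
  have hPH : P + f ⋆ₗ H = H := P_add hα hσ
  have hPQ : P + Q = K := P_add_Q hα hσ
  have hJK : J ⋆ₗ K = H := J_conv_K hα hα1 hσ
  have radd : ∀ a b c : ℝ → ℝ≥0∞, Measurable a → Measurable c →
      (a + b) ⋆ₗ c = a ⋆ₗ c + b ⋆ₗ c := by
    intro a b c ha hc
    rw [lconvolution_comm, lconv_add _ _ _ hc ha, lconvolution_comm (f := c) (g := a),
      lconvolution_comm (f := c) (g := b)]
  -- first equation
  have h1 : W = z • (f ⋆ₗ H) + z • (f ⋆ₗ W) := by
    rw [hW]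
    conv_lhs => rw [hr]
    rw [lconv_add _ _ _ mH (mf.const_smul z), lconv_smul _ _ _ mH mf, lconv_smul _ _ _ mH mfr,
      lconvolution_assoc mH mf mr, lconvolution_comm (f := H) (g := f), lconvolution_assoc mf mH mr]
  have h2 : P ⋆ₗ r + f ⋆ₗ W = W := by
    rw [hW, lconvolution_assoc mf mH mr, ← radd _ _ _ mP mr, hPH]
  have h3 : W + z • (P ⋆ₗ r) + z • P = z • H + z • W := by
    calc W + z • (P ⋆ₗ r) + z • P = z • (f ⋆ₗ H) + z • (f ⋆ₗ W) + z • (P ⋆ₗ r) + z • P := by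
          rw [← h1]
      _ = z • (P + f ⋆ₗ H) + z • (P ⋆ₗ r + f ⋆ₗ W) := by
          simp only [smul_add]; abel
      _ = _ := by rw [hPH, h2]
  have h4 : J ⋆ₗ W + z • (J ⋆ₗ (P ⋆ₗ r)) + z • (J ⋆ₗ P) = z • (J ⋆ₗ H) + z • (J ⋆ₗ W) := by
    have := congrArg (fun g => J ⋆ₗ g) h3
    rw [lconv_add _ _ _ mJ (mW.add (mPr.const_smul z)), lconv_add _ _ _ mJ mW,
      lconv_add _ _ _ mJ (mH.const_smul z), lconv_smul _ _ _ mJ mPr, lconv_smul _ _ _ mJ mP,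
      lconv_smul _ _ _ mJ mH, lconv_smul _ _ _ mJ mW] at this
    exact this
  have h5 : J ⋆ₗ (P ⋆ₗ r) + (J ⋆ₗ Q) ⋆ₗ r = W := by
    rw [lconvolution_assoc mJ mP mr, ← radd _ _ _ (measurable_lconvolution _ mJ mP) mr,
      ← lconv_add _ _ _ mJ mP, hPQ, hJK, hW]
  calc _ = J ⋆ₗ W + z • (J ⋆ₗ (P ⋆ₗ r) + (J ⋆ₗ Q) ⋆ₗ r) + z • (J ⋆ₗ P) := by rw [h5]
    _ = (J ⋆ₗ W + z • (J ⋆ₗ (P ⋆ₗ r)) + z • (J ⋆ₗ P)) + z • ((J ⋆ₗ Q) ⋆ₗ r) := by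
        simp only [smul_add]; abel
    _ = _ := by rw [h4]


/-! ### weighted norms -/

lemma wN_up {s : ℝ} {F : ℝ → ℝ} (hi : IntegrableOn (fun x => Real.exp (-s * x) * F x) (Set.Ioi 0))
    (h0 : ∀ x, 0 < x → 0 ≤ F x) :
    wN s (up F) = ENNReal.ofReal (∫ x in Set.Ioi 0, Real.exp (-s * x) * F x) := by
  rw [ofReal_integral_eq_lintegral_ofReal hi]
  · unfold wN
    rw [← lintegral_indicator measurableSet_Ioi]
    congr 1; ext x
    by_cases hx : 0 < x
    · rw [Set.indicator_of_mem (by exact hx), up_pos _ hx, ENNReal.ofReal_mul (Real.exp_pos _).le]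
    · rw [Set.indicator_of_notMem (by exact hx), up_nonpos _ (by linarith), mul_zero]
  · refine (ae_restrict_iff' measurableSet_Ioi).2 (Eventually.of_forall fun x hx => ?_)
    have := h0 x hx
    simp only [Pi.zero_apply]; positivity

lemma wN_exp {s A C : ℝ} (hs : A < s) (hC : 0 ≤ C) :
    wN s (up (fun t => C * Real.exp (A * t))) = ENNReal.ofReal (C / (s - A)) := by
  have e : (fun x => Real.exp (-s * x) * (C * Real.exp (A * x))) =
      fun x => C * Real.exp ((A - s) * x) := by
    ext x
    rw [show (A - s) * x = -s * x + A * x by ring, Real.exp_add]; ring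
  rw [wN_up]
  · rw [e, integral_const_mul, integral_exp_mul_Ioi (by linarith)]
    congr 1
    have : s - A ≠ 0 := by linarith
    have : A - s ≠ 0 := by linarith
    simp
    field_simp
    ring
  · rw [e]
    exact (integrableOn_exp_mul_Ioi (by linarith) 0).const_mul C
  · intro x _; positivity

lemma wN_H {s : ℝ} (hs : 0 < s) : wN s (up HR) = ENNReal.ofReal (1 / s) := by
  have := wN_exp (A := 0) (C := 1) hs zero_le_one
  simp only [zero_mul, Real.exp_zero, mul_one, sub_zero] at this
  exact this

lemma wN_J {α σ s : ℝ} (hα : 0 < α) (hα1 : α < 1) (hσ : 0 < σ) (hs : 0 < s) :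
    wN s (up (JR α σ)) = ENNReal.ofReal (kap α σ * s ^ (-α)) := by
  have hG := Real.Gamma_pos_of_pos hα
  have h := Real.integral_rpow_mul_exp_neg_mul_Ioi hα hs
  have e : (fun x => Real.exp (-s * x) * JR α σ x) =
      fun x => kap α σ / Real.Gamma α * (x ^ (α - 1) * Real.exp (-(s * x))) := by
    ext x
    rw [JR, neg_mul]; ring
  rw [wN_up]
  · rw [e, integral_const_mul, h]
    congr 1
    rw [Real.rpow_neg hs.le, one_div, Real.inv_rpow hs.le]
    field_simp
  · rw [e]
    refine Integrable.const_mul ?_ _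
    by_contra hc
    rw [integral_undef hc] at h
    have : 0 < (1 / s) ^ α * Real.Gamma α := by positivity
    linarith
  · intro x hx; exact JR_nonneg hα hα1 hσ hx.le

lemma lint_Q {α σ : ℝ} (hα : 0 < α) (hα1 : α < 1) (hσ : 0 < σ) : ∫⁻ x, up (QR α σ) x ≠ ⊤ := by
  have b1 : ∀ x : ℝ, 0 < x → QR α σ x ≤ σ ^ (-α) * x ^ (-α) := by
    intro x hx
    have := PR_nonneg (α := α) hσ hx.le
    unfold QR KR
    rw [Real.mul_rpow hσ.le hx.le]
    linarith
  have b2 : ∀ x : ℝ, 0 < x → QR α σ x ≤ σ ^ (-α - 1) * x ^ (-α - 1) := by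
    intro x hx
    unfold QR KR PR
    rw [← Real.mul_rpow hσ.le hx.le]
    have hu : 0 < σ * x := by positivity
    generalize σ * x = u at hu
    have h1 : (1 + u) ^ (-α) ≥ u ^ (-α) * (u / (1 + u)) := by
      have e : (1 + u) ^ (-α) = u ^ (-α) * (u / (1 + u)) ^ α := by
        rw [Real.div_rpow hu.le (by positivity), Real.rpow_neg hu.le, Real.rpow_neg (by positivity)]
        have : 0 < u ^ α := by positivity
        field_simp
      rw [e]
      have h01 : u / (1 + u) ≤ 1 := by rw [div_le_one (by positivity)]; linarith
      have := Real.rpow_le_rpow_of_exponent_ge (x := u / (1 + u)) (by positivity) h01 hα1.le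
      rw [Real.rpow_one] at this
      have hp : 0 < u ^ (-α) := by positivity
      nlinarith
    have h2 : u ^ (-α - 1) = u ^ (-α) / u := by rw [Real.rpow_sub hu, Real.rpow_one]
    rw [h2]
    have hp : 0 < u ^ (-α) := by positivity
    have h3 : u ^ (-α) - u ^ (-α) * (u / (1 + u)) ≤ u ^ (-α) / u := by
      rw [show u ^ (-α) - u ^ (-α) * (u / (1 + u)) = u ^ (-α) / (1 + u) by field_simp; ring]
      gcongr; linarith
    linarith
  have i1 : IntegrableOn (fun x : ℝ => σ ^ (-α) * x ^ (-α)) (Set.Ioc 0 1) := by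
    refine Integrable.const_mul ?_ _
    exact (intervalIntegrable_iff_integrableOn_Ioc_of_le zero_le_one).1
      (intervalIntegral.intervalIntegrable_rpow' (by linarith))
  have i2 : IntegrableOn (fun x : ℝ => σ ^ (-α - 1) * x ^ (-α - 1)) (Set.Ioi 1) := by
    refine Integrable.const_mul ?_ _
    exact integrableOn_Ioi_rpow_of_lt (by linarith) one_pos
  have j1 : ∫⁻ x in Set.Ioc 0 1, ENNReal.ofReal (QR α σ x) < ⊤ := by
    refine lt_of_le_of_lt ?_ i1.lintegral_lt_top
    exact setLIntegral_mono' measurableSet_Ioc fun x hx => ENNReal.ofReal_le_ofReal (b1 x hx.1)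
  have j2 : ∫⁻ x in Set.Ioi 1, ENNReal.ofReal (QR α σ x) < ⊤ := by
    refine lt_of_le_of_lt ?_ i2.lintegral_lt_top
    refine setLIntegral_mono' measurableSet_Ioi fun x hx => ENNReal.ofReal_le_ofReal (b2 x ?_)
    have : (1:ℝ) < x := hx
    linarith
  unfold up
  rw [lintegral_indicator measurableSet_Ioi, ← Set.Ioc_union_Ioi_eq_Ioi zero_le_one]
  refine ((lintegral_union_le _ _ _).trans_lt ?_).ne
  exact ENNReal.add_lt_top.2 ⟨j1, j2⟩

/-! ### the limit function -/

noncomputable def VR (α σ b : ℝ) : ℝ → ℝ := fun t => mlCDF α (b * kap α σ) t / b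

lemma VR_continuous {α : ℝ} (σ b : ℝ) (hα : 0 < α) : Continuous (VR α σ b) := by
  unfold VR mlCDF
  have h1 := ml_continuous hα
  have h2 : Continuous (fun t : ℝ => -(b * kap α σ) * t ^ α) :=
    continuous_const.mul (Real.continuous_rpow_const hα.le)
  exact (continuous_const.sub (h1.comp h2)).div_const b

lemma VR_zero {α : ℝ} (σ b : ℝ) (hα : 0 < α) : VR α σ b 0 = 0 := by
  unfold VR mlCDF
  rw [Real.zero_rpow hα.ne', mul_zero, ml_zero]; simp

lemma VR_bound {α σ b t : ℝ} (hα : 0 < α) (hα1 : α < 1) (hσ : 0 < σ) (hb : 0 < b) (ht : 0 ≤ t) :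
    |VR α σ b t| ≤ 3 / b * Real.exp ((2 * (b * kap α σ)) ^ (1 / α) * t) := by
  have hk := kap_pos hα1 hσ
  have h := ml_bound hα (-(b * kap α σ) * t ^ α)
  have e : (2 * |-(b * kap α σ) * t ^ α|) ^ (1 / α) = (2 * (b * kap α σ)) ^ (1 / α) * t := by
    rw [neg_mul, abs_neg, abs_of_nonneg (by positivity), ← mul_assoc,
      Real.mul_rpow (by positivity) (by positivity), ← Real.rpow_mul ht]
    rw [mul_one_div_cancel hα.ne', Real.rpow_one]
  rw [e] at h
  have h1 : 1 ≤ Real.exp ((2 * (b * kap α σ)) ^ (1 / α) * t) := Real.one_le_exp (by positivity)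
  unfold VR mlCDF
  rw [abs_div, abs_of_pos hb, div_mul_eq_mul_div]
  gcongr
  refine (abs_sub _ _).trans ?_
  rw [abs_one]; linarith

lemma JR_integrable {α : ℝ} (σ : ℝ) (hα : 0 < α) (t : ℝ) :
    IntervalIntegrable (JR α σ) volume 0 t := by
  unfold JR
  exact (intervalIntegral.intervalIntegrable_rpow' (by linarith)).const_mul _

lemma JV_integrable {α : ℝ} (σ b : ℝ) (hα : 0 < α) (t : ℝ) :
    IntervalIntegrable (fun y => JR α σ y * VR α σ b (t - y)) volume 0 t := by
  refine (JR_integrable σ hα t).mul_continuousOn (Continuous.continuousOn ?_)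
  have := VR_continuous σ b hα
  fun_prop

lemma VR_volterra' {α σ b t : ℝ} (hα : 0 < α) (hα1 : α < 1) (hσ : 0 < σ) (hb : 0 < b)
    (ht : 0 < t) :
    ∫ y in (0:ℝ)..t, JR α σ y * (1 - b * VR α σ b (t - y)) = VR α σ b t := by
  have hk := kap_pos hα1 hσ
  have hG := Real.Gamma_pos_of_pos hα
  have h := ml_volterra hα (show 0 < b * kap α σ by positivity) ht
  have e : ∀ y, JR α σ y * (1 - b * VR α σ b (t - y)) = kap α σ / Real.Gamma α *
      (y ^ (α - 1) * mittagLeffler α 1 (-(b * kap α σ) * (t - y) ^ α)) := by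
    intro y
    unfold JR VR mlCDF
    field_simp
    ring
  simp_rw [e]
  rw [intervalIntegral.integral_const_mul, h]
  unfold VR mlCDF
  field_simp

lemma VR_volterra {α σ b t : ℝ} (hα : 0 < α) (hα1 : α < 1) (hσ : 0 < σ) (hb : 0 < b)
    (ht : 0 < t) :
    VR α σ b t + b * (∫ y in (0:ℝ)..t, JR α σ y * VR α σ b (t - y)) =
      ∫ y in (0:ℝ)..t, JR α σ y := by
  rw [← VR_volterra' hα hα1 hσ hb ht, ← intervalIntegral.integral_const_mul,
    ← intervalIntegral.integral_add]
  · congr 1; ext y; ring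
  · have := (JR_integrable σ hα t).sub ((JV_integrable σ b hα t).const_mul b)
    refine this.congr fun y _ => ?_
    ring
  · exact (JV_integrable σ b hα t).const_mul b

/-! ### the comparison -/

lemma lconv_abs {α σ : ℝ} (hα : 0 < α) (hα1 : α < 1) (hσ : 0 < σ) (G : ℝ → ℝ) {t : ℝ}
    (ht : 0 < t) :
    ENNReal.ofReal |∫ y in (0:ℝ)..t, JR α σ y * G (t - y)| ≤
      (up (JR α σ) ⋆ₗ up (fun t => |G t|)) t := by
  rw [lconv_up _ _ (fun x hx => JR_nonneg hα hα1 hσ hx.le), intervalIntegral.integral_of_le ht.le,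
    integral_Ioc_eq_integral_Ioo, ← Real.enorm_eq_ofReal_abs]
  refine (enorm_integral_le_lintegral_enorm _).trans (le_of_eq ?_)
  refine setLIntegral_congr_fun measurableSet_Ioo fun y hy => ?_
  simp only [Real.enorm_eq_ofReal_abs, abs_mul, abs_of_nonneg (JR_nonneg hα hα1 hσ hy.1.le)]

noncomputable def wR (α σ ζ : ℝ) : ℝ → ℝ := fun t => (Wf α σ ζ t).toReal
noncomputable def DR (α σ ζ b : ℝ) : ℝ → ℝ := fun t => |wR α σ ζ t - VR α σ b t|

section
variable {α σ ζ b : ℝ}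

lemma wR_nonneg (t : ℝ) : 0 ≤ wR α σ ζ t := ENNReal.toReal_nonneg

lemma measurable_wR : Measurable (wR α σ ζ) := (measurable_W α σ ζ).ennreal_toReal


lemma W_ne_top (hα : 0 < α) (hσ : 0 < σ) (hζ : 0 < ζ) (hζ1 : ζ < 1)
    (t : ℝ) : Wf α σ ζ t ≠ ⊤ :=
  ((W_le hα hσ hζ hζ1 t).trans_lt ENNReal.ofReal_lt_top).ne

lemma wR_le (hα : 0 < α) (hσ : 0 < σ) (hζ : 0 < ζ) (hζ1 : ζ < 1)
    (t : ℝ) : wR α σ ζ t ≤ ζ / (1 - ζ) :=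
  ENNReal.toReal_le_of_le_ofReal (div_nonneg hζ.le (by linarith)) (W_le hα hσ hζ hζ1 t)

lemma wR_mono (hα : 0 < α) (hσ : 0 < σ) (hζ : 0 < ζ) (hζ1 : ζ < 1)
    : Monotone (wR α σ ζ) := fun _ _ hst =>
  ENNReal.toReal_mono (W_ne_top hα hσ hζ hζ1 _) (W_mono α σ ζ hst)

lemma W_eq_up (hα : 0 < α) (hσ : 0 < σ) (hζ : 0 < ζ) (hζ1 : ζ < 1)
    : Wf α σ ζ = up (wR α σ ζ) := by
  ext t
  rcases le_or_gt t 0 with ht | ht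
  · rw [up_nonpos _ ht, W_nonpos _ _ _ _ ht]
  · rw [up_pos _ ht, wR, ENNReal.ofReal_toReal (W_ne_top hα hσ hζ hζ1 t)]

lemma Jw_integrable (hα : 0 < α) (hσ : 0 < σ) (hζ : 0 < ζ) (hζ1 : ζ < 1)
    {t : ℝ} (ht : 0 ≤ t) :
    IntervalIntegrable (fun y => JR α σ y * wR α σ ζ (t - y)) volume 0 t := by
  have h := JR_integrable (α := α) σ hα t
  rw [intervalIntegrable_iff] at h ⊢
  refine Integrable.mul_bdd (c := ζ / (1 - ζ)) h ?_ ?_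
  · have := measurable_wR (α := α) (σ := σ) (ζ := ζ)
    apply Measurable.aestronglyMeasurable
    fun_prop
  · refine Eventually.of_forall fun y => ?_
    rw [Real.norm_of_nonneg (wR_nonneg _)]
    exact wR_le hα hσ hζ hζ1 _

lemma real_identity (hα : 0 < α) (hα1 : α < 1) (hσ : 0 < σ) (hζ : 0 < ζ) (hζ1 : ζ < 1)
    {t : ℝ} (ht : 0 < t) :
    (∫ y in (0:ℝ)..t, JR α σ y * wR α σ ζ (t - y)) + ζ * wR α σ ζ t
      + ζ * ((up (JR α σ) ⋆ₗ up (PR α σ)) t).toReal =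
    ζ * (∫ y in (0:ℝ)..t, JR α σ y) + ζ * (∫ y in (0:ℝ)..t, JR α σ y * wR α σ ζ (t - y))
      + ζ * (((up (JR α σ) ⋆ₗ up (QR α σ)) ⋆ₗ res α σ ζ) t).toReal := by
  have key := congrFun (key_ennreal (ζ := ζ) hα hα1 hσ) t
  simp only [Pi.add_apply, Pi.smul_apply, smul_eq_mul] at key
  have hJ0 : ∀ x, 0 < x → 0 ≤ JR α σ x := fun x hx => JR_nonneg hα hα1 hσ hx.le
  have eW : (up (JR α σ) ⋆ₗ Wf α σ ζ) t =
      ENNReal.ofReal (∫ y in (0:ℝ)..t, JR α σ y * wR α σ ζ (t - y)) := by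
    rw [W_eq_up hα hσ hζ hζ1, lconv_up _ _ hJ0, lint_Ioo_ofReal ht.le]
    · exact Jw_integrable hα hσ hζ hζ1 ht.le
    · intro y hy _; exact mul_nonneg (hJ0 y hy) (wR_nonneg _)
  have eH : (up (JR α σ) ⋆ₗ up HR) t = ENNReal.ofReal (∫ y in (0:ℝ)..t, JR α σ y) := by
    rw [lconv_up _ _ hJ0]
    simp only [HR, mul_one]
    rw [lint_Ioo_ofReal ht.le (JR_integrable σ hα t) (fun y hy _ => hJ0 y hy)]
  have hPK : ∀ x, up (PR α σ) x ≤ up (KR α σ) x := fun x => by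
    rw [← P_add_Q hα hσ]; exact le_self_add
  have hQK : ∀ x, up (QR α σ) x ≤ up (KR α σ) x := fun x => by
    rw [← P_add_Q hα hσ]; exact le_add_self
  have fP : (up (JR α σ) ⋆ₗ up (PR α σ)) t ≠ ⊤ := by
    refine ((lconv_mono hPK t).trans_lt ?_).ne
    rw [J_conv_K hα hα1 hσ, up_pos _ ht]; exact ENNReal.ofReal_lt_top
  have fQ : ((up (JR α σ) ⋆ₗ up (QR α σ)) ⋆ₗ res α σ ζ) t ≠ ⊤ := by
    rw [lconvolution_comm]
    refine ((lconv_mono (h := up HR) (fun x => ?_) t).trans_lt ?_).ne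
    · rw [← J_conv_K hα hα1 hσ]; exact lconv_mono hQK x
    · rw [lconvolution_comm]; exact (W_ne_top hα hσ hζ hζ1 t).lt_top
  have n1 : 0 ≤ ∫ y in (0:ℝ)..t, JR α σ y * wR α σ ζ (t - y) :=
    intervalIntegral.integral_nonneg ht.le fun y hy =>
      mul_nonneg (JR_nonneg hα hα1 hσ hy.1) (wR_nonneg _)
  have n2 : 0 ≤ ∫ y in (0:ℝ)..t, JR α σ y :=
    intervalIntegral.integral_nonneg ht.le fun y hy => JR_nonneg hα hα1 hσ hy.1
  rw [eW, eH, W_eq_up hα hσ hζ hζ1, up_pos _ ht, ← ENNReal.ofReal_toReal fP,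
    ← ENNReal.ofReal_toReal fQ] at key
  have n3 := wR_nonneg (α := α) (σ := σ) (ζ := ζ) t
  have n4 : 0 ≤ ((up (JR α σ) ⋆ₗ up (PR α σ)) t).toReal := ENNReal.toReal_nonneg
  have n5 : 0 ≤ (((up (JR α σ) ⋆ₗ up (QR α σ)) ⋆ₗ res α σ ζ) t).toReal := ENNReal.toReal_nonneg
  rw [← ENNReal.ofReal_mul hζ.le, ← ENNReal.ofReal_mul hζ.le, ← ENNReal.ofReal_mul hζ.le,
    ← ENNReal.ofReal_mul hζ.le, ← ENNReal.ofReal_mul hζ.le,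
    ← ENNReal.ofReal_add n1 (by positivity), ← ENNReal.ofReal_add (by positivity) (by positivity),
    ← ENNReal.ofReal_add (by positivity) (by positivity),
    ← ENNReal.ofReal_add (by positivity) (by positivity),
    ENNReal.ofReal_eq_ofReal_iff (by positivity) (by positivity)] at key
  exact key

lemma D_ineq (hα : 0 < α) (hα1 : α < 1) (hσ : 0 < σ) (hζ : 0 < ζ) (hζ1 : ζ < 1) (hb : 0 < b)
    (t : ℝ) :
    ENNReal.ofReal ζ * up (DR α σ ζ b) t ≤
      ENNReal.ofReal (1 - ζ) * (up (JR α σ) ⋆ₗ up (DR α σ ζ b)) t +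
      ENNReal.ofReal |ζ * b - (1 - ζ)| * (up (JR α σ) ⋆ₗ up (fun t => |VR α σ b t|)) t +
      ENNReal.ofReal ζ * ((up (JR α σ) ⋆ₗ up (QR α σ)) ⋆ₗ res α σ ζ) t +
      ENNReal.ofReal ζ * (up (JR α σ) ⋆ₗ up (KR α σ)) t := by
  rcases le_or_gt t 0 with ht | ht
  · simp [up_nonpos _ ht]
  have h1 := real_identity hα hα1 hσ hζ hζ1 ht
  have h2 := VR_volterra hα hα1 hσ hb ht
  have hD := lconv_abs hα hα1 hσ (fun t => wR α σ ζ t - VR α σ b t) ht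
  have hV := lconv_abs hα hα1 hσ (VR α σ b) ht
  have hP : ENNReal.ofReal ((up (JR α σ) ⋆ₗ up (PR α σ)) t).toReal ≤
      (up (JR α σ) ⋆ₗ up (KR α σ)) t := by
    refine ENNReal.ofReal_toReal_le.trans (lconv_mono (fun x => ?_) t)
    rw [← P_add_Q hα hσ]; exact le_self_add
  have hQ : ENNReal.ofReal (((up (JR α σ) ⋆ₗ up (QR α σ)) ⋆ₗ res α σ ζ) t).toReal ≤
      ((up (JR α σ) ⋆ₗ up (QR α σ)) ⋆ₗ res α σ ζ) t := ENNReal.ofReal_toReal_le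
  have hsplit : ∫ y in (0:ℝ)..t, JR α σ y * (wR α σ ζ (t - y) - VR α σ b (t - y)) =
      (∫ y in (0:ℝ)..t, JR α σ y * wR α σ ζ (t - y)) -
        ∫ y in (0:ℝ)..t, JR α σ y * VR α σ b (t - y) := by
    rw [← intervalIntegral.integral_sub (Jw_integrable hα hσ hζ hζ1 ht.le) (JV_integrable σ b hα t)]
    congr 1; ext y; ring
  rw [hsplit] at hD
  have n4 : 0 ≤ ((up (JR α σ) ⋆ₗ up (PR α σ)) t).toReal := ENNReal.toReal_nonneg
  have n5 : 0 ≤ (((up (JR α σ) ⋆ₗ up (QR α σ)) ⋆ₗ res α σ ζ) t).toReal := ENNReal.toReal_nonneg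
  set p := ((up (JR α σ) ⋆ₗ up (PR α σ)) t).toReal
  set q := (((up (JR α σ) ⋆ₗ up (QR α σ)) ⋆ₗ res α σ ζ) t).toReal
  set jw := ∫ y in (0:ℝ)..t, JR α σ y * wR α σ ζ (t - y)
  set jv := ∫ y in (0:ℝ)..t, JR α σ y * VR α σ b (t - y)
  set jh := ∫ y in (0:ℝ)..t, JR α σ y
  have hz : 0 ≤ 1 - ζ := by linarith
  have hreal : ζ * DR α σ ζ b t ≤ (1 - ζ) * |jw - jv| + |ζ * b - (1 - ζ)| * |jv| + ζ * q + ζ * p := by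
    unfold DR
    have e : ζ * (wR α σ ζ t - VR α σ b t) =
        -((1 - ζ) * (jw - jv)) + (ζ * b - (1 - ζ)) * jv + ζ * q - ζ * p := by
      linear_combination h1 - ζ * h2
    rw [← abs_of_pos hζ, ← abs_mul, abs_of_pos hζ, e]
    have a1 := abs_sub (-((1 - ζ) * (jw - jv)) + (ζ * b - (1 - ζ)) * jv + ζ * q) (ζ * p)
    have a2 := abs_add_le (-((1 - ζ) * (jw - jv)) + (ζ * b - (1 - ζ)) * jv) (ζ * q)
    have a3 := abs_add_le (-((1 - ζ) * (jw - jv))) ((ζ * b - (1 - ζ)) * jv)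
    rw [abs_neg, abs_mul, abs_mul, abs_of_nonneg hz] at a3
    rw [abs_of_nonneg (show 0 ≤ ζ * q by positivity)] at a2
    rw [abs_of_nonneg (show 0 ≤ ζ * p by positivity)] at a1
    linarith
  rw [up_pos _ ht, ← ENNReal.ofReal_mul hζ.le]
  refine (ENNReal.ofReal_le_ofReal hreal).trans ?_
  rw [ENNReal.ofReal_add (by positivity) (by positivity),
    ENNReal.ofReal_add (by positivity) (by positivity),
    ENNReal.ofReal_add (by positivity) (by positivity), ENNReal.ofReal_mul hz,
    ENNReal.ofReal_mul (abs_nonneg _), ENNReal.ofReal_mul hζ.le, ENNReal.ofReal_mul hζ.le]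
  gcongr
  exact hD

lemma measurable_DR (hα : 0 < α) (hσ : 0 < σ) (hζ : 0 < ζ) (hζ1 : ζ < 1)
    : Measurable (DR α σ ζ b) := by
  have h1 := measurable_wR (α := α) (σ := σ) (ζ := ζ)
  have h2 := (VR_continuous σ b hα).measurable
  have : Measurable (fun t => wR α σ ζ t - VR α σ b t) := h1.sub h2
  exact this.abs

lemma wN_V (hα : 0 < α) (hα1 : α < 1) (hσ : 0 < σ) (hζ : 0 < ζ) (hζ1 : ζ < 1) (hb : 0 < b)
    {s : ℝ} (hs : (2 * (b * kap α σ)) ^ (1 / α) < s) :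
    wN s (up (fun t => |VR α σ b t|)) ≤
      ENNReal.ofReal (3 / b / (s - (2 * (b * kap α σ)) ^ (1 / α))) := by
  rw [← wN_exp hs (by positivity)]
  refine wN_mono s fun x => ?_
  rcases le_or_gt x 0 with hx | hx
  · simp [up_nonpos _ hx]
  · rw [up_pos _ hx, up_pos _ hx]
    exact ENNReal.ofReal_le_ofReal (VR_bound hα hα1 hσ hb hx.le)

lemma wN_D_ne_top (hα : 0 < α) (hα1 : α < 1) (hσ : 0 < σ) (hζ : 0 < ζ) (hζ1 : ζ < 1) (hb : 0 < b)
    {s : ℝ} (hs : (2 * (b * kap α σ)) ^ (1 / α) < s) :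
    wN s (up (DR α σ ζ b)) ≠ ⊤ := by
  have hk := kap_pos hα1 hσ
  have hs0 : 0 < s := lt_of_le_of_lt (by positivity) hs
  have h : ∀ x, up (DR α σ ζ b) x ≤
      (ENNReal.ofReal (ζ / (1 - ζ)) • up HR + up (fun t => |VR α σ b t|)) x := by
    intro x
    rcases le_or_gt x 0 with hx | hx
    · simp [up_nonpos _ hx]
    · have hz : 0 ≤ ζ / (1 - ζ) := div_nonneg hζ.le (by linarith)
      rw [Pi.add_apply, Pi.smul_apply, up_pos _ hx, up_pos _ hx, up_pos _ hx, smul_eq_mul,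
        ← ENNReal.ofReal_mul hz, ← ENNReal.ofReal_add (by simpa [HR]) (abs_nonneg _)]
      apply ENNReal.ofReal_le_ofReal
      unfold DR HR
      refine (abs_sub _ _).trans ?_
      rw [abs_of_nonneg (wR_nonneg _)]
      linarith [wR_le hα hσ hζ hζ1 x]
  refine ((wN_mono s h).trans_lt ?_).ne
  rw [wN_add _ _ _ (measurable_H.const_smul _), wN_smul _ _ _ measurable_H, wN_H hs0,
    ← ENNReal.ofReal_mul (div_nonneg hζ.le (by linarith))]
  exact ENNReal.add_lt_top.2 ⟨ENNReal.ofReal_lt_top,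
    (wN_V hα hα1 hσ hζ hζ1 hb hs).trans_lt ENNReal.ofReal_lt_top⟩

lemma main_bound (hα : 0 < α) (hα1 : α < 1) (hσ : 0 < σ) (hζ : 0 < ζ) (hζ1 : ζ < 1) (hb : 0 < b)
    {s : ℝ} (hs : (2 * (b * kap α σ)) ^ (1 / α) < s) :
    ζ * (wN s (up (DR α σ ζ b))).toReal ≤
      (1 - ζ) * (kap α σ * s ^ (-α)) * (wN s (up (DR α σ ζ b))).toReal +
      |ζ * b - (1 - ζ)| * (kap α σ * s ^ (-α)) * (3 / b / (s - (2 * (b * kap α σ)) ^ (1 / α))) +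
      ζ * (kap α σ * s ^ (-α)) * (∫⁻ x, up (QR α σ) x).toReal * (ζ / (1 - ζ)) +
      ζ / s := by
  have hk := kap_pos hα1 hσ
  have hs0 : 0 < s := lt_of_le_of_lt (by positivity) hs
  have hz : 0 ≤ 1 - ζ := by linarith
  have hz2 : 0 ≤ ζ / (1 - ζ) := div_nonneg hζ.le (by linarith)
  have hfin := wN_D_ne_top hα hα1 hσ hζ hζ1 hb hs
  have hQfin := lint_Q hα hα1 hσ
  have mJ := measurable_J α σ
  have mD : Measurable (up (DR α σ ζ b)) := measurable_up (measurable_DR hα hσ hζ hζ1)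
  have mV : Measurable (up (fun t => |VR α σ b t|)) :=
    measurable_up ((VR_continuous σ b hα).measurable.abs)
  have mQ := measurable_Q α σ
  have mr := measurable_res α σ ζ
  have mK := measurable_K α σ
  have c1 := measurable_lconvolution volume mJ mD
  have c2 := measurable_lconvolution volume mJ mV
  have c3 := measurable_lconvolution volume (measurable_lconvolution volume mJ mQ) mr
  have c4 := measurable_lconvolution volume mJ mK
  have hN := wN_mono s (f := ENNReal.ofReal ζ • up (DR α σ ζ b))
    (g := ENNReal.ofReal (1 - ζ) • (up (JR α σ) ⋆ₗ up (DR α σ ζ b)) +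
      ENNReal.ofReal |ζ * b - (1 - ζ)| • (up (JR α σ) ⋆ₗ up (fun t => |VR α σ b t|)) +
      ENNReal.ofReal ζ • ((up (JR α σ) ⋆ₗ up (QR α σ)) ⋆ₗ res α σ ζ) +
      ENNReal.ofReal ζ • (up (JR α σ) ⋆ₗ up (KR α σ))) (D_ineq hα hα1 hσ hζ hζ1 hb)
  rw [wN_add _ _ _ (((c1.const_smul _).add (c2.const_smul _)).add (c3.const_smul _)),
    wN_add _ _ _ ((c1.const_smul _).add (c2.const_smul _)), wN_add _ _ _ (c1.const_smul _),
    wN_smul _ _ _ mD, wN_smul _ _ _ c1, wN_smul _ _ _ c2, wN_smul _ _ _ c3, wN_smul _ _ _ c4,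
    wN_lconv _ _ _ mJ mD, wN_lconv _ _ _ mJ mV, wN_lconv _ _ _ (measurable_lconvolution _ mJ mQ) mr,
    wN_lconv _ _ _ mJ mQ, J_conv_K hα hα1 hσ, wN_H hs0, wN_J hα hα1 hσ hs0] at hN
  have hQ' : wN s (up (QR α σ)) ≤ ENNReal.ofReal (∫⁻ x, up (QR α σ) x).toReal := by
    rw [ENNReal.ofReal_toReal hQfin]
    exact wN_le_lintegral hs0.le _ (fun x hx => up_nonpos _ hx)
  have hr' : wN s (res α σ ζ) ≤ ENNReal.ofReal (ζ / (1 - ζ)) :=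
    (wN_le_lintegral hs0.le _ (res_nonpos α σ ζ)).trans (lint_res hα hσ hζ hζ1)
  have hV' := wN_V hα hα1 hσ hζ hζ1 hb hs
  have hsA : 0 < s - (2 * (b * kap α σ)) ^ (1 / α) := by linarith
  set X := (wN s (up (DR α σ ζ b))).toReal with hX
  have hX0 : 0 ≤ X := ENNReal.toReal_nonneg
  have hXe : wN s (up (DR α σ ζ b)) = ENNReal.ofReal X := (ENNReal.ofReal_toReal hfin).symm
  set q := (∫⁻ x, up (QR α σ) x).toReal
  have hq0 : 0 ≤ q := ENNReal.toReal_nonneg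
  set j := kap α σ * s ^ (-α) with hj
  have hj0 : 0 ≤ j := by positivity
  have hN2 : ENNReal.ofReal ζ * ENNReal.ofReal X ≤
      ENNReal.ofReal (1 - ζ) * (ENNReal.ofReal j * ENNReal.ofReal X) +
      ENNReal.ofReal |ζ * b - (1 - ζ)| * (ENNReal.ofReal j *
        ENNReal.ofReal (3 / b / (s - (2 * (b * kap α σ)) ^ (1 / α)))) +
      ENNReal.ofReal ζ * (ENNReal.ofReal j * ENNReal.ofReal q * ENNReal.ofReal (ζ / (1 - ζ))) +
      ENNReal.ofReal ζ * ENNReal.ofReal (1 / s) := by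
    rw [← hXe]
    refine hN.trans ?_
    gcongr
  have hlast : 0 ≤ 3 / b / (s - (2 * (b * kap α σ)) ^ (1 / α)) := by positivity
  simp only [← ENNReal.ofReal_mul hζ.le, ← ENNReal.ofReal_mul hj0, ← ENNReal.ofReal_mul hz,
    ← ENNReal.ofReal_mul (abs_nonneg (ζ * b - (1 - ζ))),
    ← ENNReal.ofReal_mul (mul_nonneg hj0 hq0)] at hN2
  rw [← ENNReal.ofReal_add (by positivity) (by positivity),
    ← ENNReal.ofReal_add (by positivity) (by positivity),
    ← ENNReal.ofReal_add (by positivity) (by positivity),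
    ENNReal.ofReal_le_ofReal_iff (by positivity)] at hN2
  refine hN2.trans (le_of_eq ?_)
  ring

lemma lower_bound (hα : 0 < α) (hσ : 0 < σ) (hζ : 0 < ζ) (hζ1 : ζ < 1)
    {s T0 T1 c : ℝ} (hs : 0 ≤ s) (h0 : 0 ≤ T0) (h01 : T0 ≤ T1) (hc : 0 ≤ c)
    (hfin : wN s (up (DR α σ ζ b)) ≠ ⊤)
    (h : ∀ T, T0 < T → T < T1 → c ≤ DR α σ ζ b T) :
    (T1 - T0) * Real.exp (-s * T1) * c ≤ (wN s (up (DR α σ ζ b))).toReal := by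
  rw [← ENNReal.ofReal_le_iff_le_toReal hfin]
  calc ENNReal.ofReal ((T1 - T0) * Real.exp (-s * T1) * c)
      = ∫⁻ x in Set.Ioo T0 T1, ENNReal.ofReal (Real.exp (-s * T1) * c) := by
        rw [setLIntegral_const, Real.volume_Ioo, ← ENNReal.ofReal_mul (by positivity)]
        congr 1; ring
    _ ≤ ∫⁻ x in Set.Ioo T0 T1, ENNReal.ofReal (Real.exp (-s * x)) * up (DR α σ ζ b) x := by
        refine setLIntegral_mono' measurableSet_Ioo fun x hx => ?_
        rw [up_pos _ (lt_of_le_of_lt h0 hx.1), ← ENNReal.ofReal_mul (Real.exp_pos _).le]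
        apply ENNReal.ofReal_le_ofReal
        have := h x hx.1 hx.2
        have hx2 := hx.2
        gcongr ?_ * ?_
        · apply Real.exp_le_exp.2
          nlinarith
    _ ≤ _ := setLIntegral_le_lintegral _ _

end


/-! ### soft analysis -/

lemma polya {Un : ℕ → ℝ → ℝ} {U : ℝ → ℝ} {m : ℕ → ℝ} {L : ℝ}
    (hmono : ∀ᶠ n in atTop, MonotoneOn (Un n) (Set.Ici 0))
    (hm : Tendsto m atTop (𝓝 L)) (hle : ∀ᶠ n in atTop, ∀ t, 0 ≤ t → Un n t ≤ m n)
    (hU : Continuous U) (hUmono : MonotoneOn U (Set.Ici 0)) (hUL : ∀ t, 0 ≤ t → U t ≤ L)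
    (hpt : ∀ t, 0 ≤ t → Tendsto (fun n => Un n t) atTop (𝓝 (U t)))
    (htail : ∀ ε > 0, ∃ T, 0 ≤ T ∧ L - ε < U T) :
    TendstoUniformlyOn Un U atTop (Set.Ici 0) := by
  have hpt' : ∀ t, 0 ≤ t → ∀ ε > 0, ∀ᶠ n in atTop, |Un n t - U t| < ε := by
    intro t ht ε hε
    have := Metric.tendsto_nhds.1 (hpt t ht) ε hε
    simpa [Real.dist_eq] using this
  rw [Metric.tendstoUniformlyOn_iff]
  intro ε hε
  obtain ⟨T, hT0, hT⟩ := htail (ε / 4) (by linarith)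
  have hcpt : TendstoUniformlyOn Un U atTop (Set.Icc 0 T) := by
    rw [← tendstoLocallyUniformlyOn_iff_tendstoUniformlyOn_of_compact isCompact_Icc,
      Metric.tendstoLocallyUniformlyOn_iff]
    intro η hη x hx
    obtain ⟨δ, hδ, hδU⟩ := Metric.continuous_iff.1 hU x (η / 4) (by linarith)
    set a := max (x - δ / 2) 0
    set c := x + δ / 2
    have ha0 : 0 ≤ a := le_max_right _ _
    have hc0 : 0 ≤ c := by have := hx.1; positivity
    have hax : a ≤ x := max_le (by linarith) hx.1
    have hax' : x - δ / 2 ≤ a := le_max_left _ _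
    refine ⟨Set.Icc 0 T ∩ Set.Ioo (x - δ / 2) (x + δ / 2), ?_, ?_⟩
    · exact inter_mem self_mem_nhdsWithin
        (mem_nhdsWithin_of_mem_nhds (Ioo_mem_nhds (by linarith) (by linarith)))
    · filter_upwards [hmono, hpt' a ha0 (η / 4) (by linarith), hpt' c hc0 (η / 4) (by linarith)]
        with n hn h1 h2 y hy
      have hy0 : 0 ≤ y := hy.1.1
      have hay : a ≤ y := max_le hy.2.1.le hy0
      have hyc : y ≤ c := hy.2.2.le
      have m1 := hn ha0 hy0 hay
      have m2 := hn hy0 hc0 hyc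
      have d : ∀ z, x - δ / 2 ≤ z → z ≤ x + δ / 2 → |U z - U x| < η / 4 := by
        intro z hz1 hz2
        have := hδU z (by rw [Real.dist_eq, abs_lt]; constructor <;> linarith)
        rwa [Real.dist_eq] at this
      have d1 := abs_lt.1 (d a hax' (by linarith))
      have d2 := abs_lt.1 (d c (by simp only [c]; linarith) le_rfl)
      have d3 := abs_lt.1 (d y hy.2.1.le hy.2.2.le)
      have e1 := abs_lt.1 h1
      have e2 := abs_lt.1 h2
      rw [Real.dist_eq, abs_lt]
      constructor <;> linarith [d1.1, d1.2, d2.1, d2.2, d3.1, d3.2, e1.1, e1.2, e2.1, e2.2]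
  have hmL : ∀ᶠ n in atTop, m n < L + ε / 4 := hm.eventually_lt_const (by linarith)
  filter_upwards [Metric.tendstoUniformlyOn_iff.1 hcpt ε hε, hmono, hle, hmL,
    hpt' T hT0 (ε / 4) (by linarith)] with n h1 h2 h3 h4 h5 t ht
  have ht0 : 0 ≤ t := ht
  rcases le_or_gt t T with htT | htT
  · exact h1 t ⟨ht, htT⟩
  · have a1 := h2 hT0 ht htT.le
    have a2 := h3 t ht
    have a3 := hUmono hT0 ht htT.le
    have a4 := hUL t ht
    have a5 := abs_lt.1 h5
    rw [Real.dist_eq, abs_lt]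
    constructor <;> linarith [a5.1, a5.2]

lemma ptwise {Un : ℕ → ℝ → ℝ} {U : ℝ → ℝ} {Y : ℕ → ℝ} {lam : ℝ}
    (hmono : ∀ᶠ n in atTop, MonotoneOn (Un n) (Set.Ici 0))
    (hU : Continuous U) (hU0 : U 0 = 0) (hUn0 : ∀ᶠ n in atTop, 0 ≤ Un n 0)
    (hY : Tendsto Y atTop (𝓝 0))
    (hlow : ∀ᶠ n in atTop, ∀ t0 t1 c : ℝ, 0 ≤ t0 → t0 < t1 → 0 < c →
      (∀ t, t0 < t → t < t1 → c ≤ |Un n t - U t|) → (t1 - t0) * Real.exp (-lam * t1) * c ≤ Y n)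
    (t : ℝ) (ht : 0 ≤ t) : Tendsto (fun n => Un n t) atTop (𝓝 (U t)) := by
  rw [Metric.tendsto_nhds]
  intro ε hε
  obtain ⟨δ, hδ, hδU⟩ := Metric.continuous_iff.1 hU t (ε / 2) (by linarith)
  have d : ∀ z, |z - t| < δ → |U z - U t| < ε / 2 := fun z hz => hδU z hz
  have up1 : ∀ᶠ n in atTop, Un n t < U t + ε := by
    have hc : 0 < (t + δ - t) * Real.exp (-lam * (t + δ)) * (ε / 2) := by
      rw [add_sub_cancel_left]; positivity
    filter_upwards [hmono, hlow, hY.eventually_lt_const hc] with n h1 h2 h3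
    by_contra hcon
    push Not at hcon
    refine absurd (h2 t (t + δ) (ε / 2) ht (by linarith) (by linarith) fun x hx1 hx2 => ?_) (not_le.2 h3)
    have a1 := h1 ht (show (0:ℝ) ≤ x by linarith) hx1.le
    have a2 := abs_lt.1 (d x (by rw [abs_lt]; constructor <;> linarith))
    refine le_trans ?_ (le_abs_self _)
    linarith [a2.2]
  have lo1 : ∀ᶠ n in atTop, U t - ε < Un n t := by
    rcases ht.eq_or_lt with h0 | hpos
    · rw [← h0, hU0]
      filter_upwards [hUn0] with n hn
      linarith
    · set a := max (t - δ) 0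
      have ha0 : 0 ≤ a := le_max_right _ _
      have hat : a < t := max_lt (by linarith) hpos
      have had : t - δ ≤ a := le_max_left _ _
      have hc : 0 < (t - a) * Real.exp (-lam * t) * (ε / 2) := by
        have : 0 < t - a := by linarith
        positivity
      filter_upwards [hmono, hlow, hY.eventually_lt_const hc] with n h1 h2 h3
      by_contra hcon
      push Not at hcon
      refine absurd (h2 a t (ε / 2) ha0 hat (by linarith) fun x hx1 hx2 => ?_) (not_le.2 h3)
      have a1 := h1 (show (0:ℝ) ≤ x by linarith) ht hx2.le
      have a2 := abs_lt.1 (d x (by rw [abs_lt]; constructor <;> linarith))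
      refine le_trans ?_ (neg_le_abs _)
      linarith [a2.1]
  filter_upwards [up1, lo1] with n h1 h2
  rw [Real.dist_eq, abs_lt]
  constructor <;> linarith

lemma VR_scale {α σ b n t : ℝ} (hn : 0 < n) (ht : 0 ≤ t) :
    VR α σ (b * n ^ (-α)) (n * t) = n ^ α * VR α σ b t := by
  unfold VR mlCDF
  have hN : 0 < n ^ α := by positivity
  rw [Real.mul_rpow hn.le ht, Real.rpow_neg hn.le]
  have : -(b * (n ^ α)⁻¹ * kap α σ) * (n ^ α * t ^ α) = -(b * kap α σ) * t ^ α := by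
    field_simp
  rw [this]
  field_simp

lemma VR_tail {α σ b : ℝ} (hα : 0 < α) (hα1 : α < 1) (hσ : 0 < σ) (hb : 0 < b)
    (hm : MonotoneOn (VR α σ b) (Set.Ici 0)) (hL : ∀ t, 0 ≤ t → VR α σ b t ≤ 1 / b) :
    ∀ ε > 0, ∃ T, 0 ≤ T ∧ 1 / b - ε < VR α σ b T := by
  intro ε hε
  have hk := kap_pos hα1 hσ
  have hG := Real.Gamma_pos_of_pos hα
  set c := kap α σ / Real.Gamma α / α with hc
  have hc0 : 0 < c := by positivity
  have hlim : Tendsto (fun t : ℝ => ε * b * c * t ^ α) atTop atTop :=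
    (tendsto_rpow_atTop hα).const_mul_atTop (by positivity)
  obtain ⟨T, hT1, hT0⟩ := ((hlim.eventually_gt_atTop (1 / b)).and (eventually_gt_atTop 0)).exists
  refine ⟨T, hT0.le, ?_⟩
  by_contra hcon
  push Not at hcon
  have hv := VR_volterra' hα hα1 hσ hb hT0
  have hJ : ∫ y in (0:ℝ)..T, JR α σ y * (ε * b) = ε * b * c * T ^ α := by
    rw [intervalIntegral.integral_mul_const]
    unfold JR
    rw [intervalIntegral.integral_const_mul, integral_rpow (Or.inl (by linarith))]
    rw [sub_add_cancel, Real.zero_rpow hα.ne', hc]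
    field_simp
    ring
  have hle : ∫ y in (0:ℝ)..T, JR α σ y * (ε * b) ≤
      ∫ y in (0:ℝ)..T, JR α σ y * (1 - b * VR α σ b (T - y)) := by
    refine intervalIntegral.integral_mono_on hT0.le ((JR_integrable σ hα T).mul_const _) ?_ ?_
    · refine (JR_integrable σ hα T).mul_continuousOn (Continuous.continuousOn ?_)
      have := VR_continuous σ b hα
      fun_prop
    · intro y hy
      refine mul_le_mul_of_nonneg_left ?_ (JR_nonneg hα hα1 hσ hy.1)
      have h1 := hm (show (0:ℝ) ≤ T - y by linarith [hy.2]) hT0.le (by linarith [hy.1])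
      have h2 : b * VR α σ b (T - y) ≤ b * (1 / b - ε) := by gcongr; linarith
      rw [mul_sub, mul_one_div_cancel hb.ne'] at h2
      linarith
  rw [hv, hJ] at hle
  linarith [hL T hT0.le]


/-- The weighted `L¹` distance, rescaled. -/
noncomputable def Yf (α σ b lam : ℝ) (ζ : ℕ → ℝ) (n : ℕ) : ℝ :=
  (wN (lam / n) (up (DR α σ (ζ n) (b * (n:ℝ) ^ (-α))))).toReal / ((n:ℝ) * (n:ℝ) ^ α)

lemma A_scale {α k b n : ℝ} (hα : 0 < α) (hk : 0 < k) (hb : 0 < b) (hn : 0 < n) :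
    (2 * (b * n ^ (-α) * k)) ^ (1 / α) = (2 * (b * k)) ^ (1 / α) / n := by
  rw [show 2 * (b * n ^ (-α) * k) = (2 * (b * k)) * n ^ (-α) by ring,
    Real.mul_rpow (by positivity) (by positivity), ← Real.rpow_mul hn.le]
  rw [show -α * (1 / α) = -1 by field_simp, Real.rpow_neg_one]
  rfl

lemma Y_bound {α σ b lam : ℝ} (hα : 0 < α) (hα1 : α < 1) (hσ : 0 < σ) (hb : 0 < b)
    (hlam : (2 * (b * kap α σ)) ^ (1 / α) < lam) {ζ : ℕ → ℝ} {n : ℕ} (hn : 1 ≤ n)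
    (hζ : ζ n ∈ Set.Ioo (0:ℝ) 1) :
    (ζ n - (n:ℝ) ^ α * (1 - ζ n) * (kap α σ * lam ^ (-α))) * Yf α σ b lam ζ n ≤
      |ζ n * b - (n:ℝ) ^ α * (1 - ζ n)| *
        (kap α σ * lam ^ (-α) * (3 / b / (lam - (2 * (b * kap α σ)) ^ (1 / α)))) +
      ζ n ^ 2 * (kap α σ * lam ^ (-α) * (∫⁻ x, up (QR α σ) x).toReal) /
        ((n:ℝ) ^ α * (1 - ζ n)) * (n:ℝ) ^ (-(1 - α)) +
      ζ n / lam * (n:ℝ) ^ (-α) := by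
  have hk := kap_pos hα1 hσ
  have hlam0 : 0 < lam := lt_of_le_of_lt (by positivity) hlam
  have hn0 : (0:ℝ) < n := by exact_mod_cast hn
  obtain ⟨h0, h1⟩ := hζ
  have hN : 0 < (n:ℝ) ^ α := by positivity
  have hA := A_scale (α := α) (k := kap α σ) hα hk hb hn0
  have hs : (2 * (b * (n:ℝ) ^ (-α) * kap α σ)) ^ (1 / α) < lam / n := by rw [hA]; gcongr
  have hb' : 0 < b * (n:ℝ) ^ (-α) := by positivity
  have M := main_bound hα hα1 hσ h0 h1 hb' hs
  rw [hA] at M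
  unfold Yf
  set X := (wN (lam / n) (up (DR α σ (ζ n) (b * (n:ℝ) ^ (-α))))).toReal
  set A := (2 * (b * kap α σ)) ^ (1 / α)
  set q := (∫⁻ x, up (QR α σ) x).toReal
  have hsa : (lam / n) ^ (-α) = lam ^ (-α) * (n:ℝ) ^ α := by
    rw [Real.div_rpow hlam0.le hn0.le, Real.rpow_neg hn0.le]
    field_simp
  rw [hsa, Real.rpow_neg hn0.le α] at M
  have hn1 : (n:ℝ) ^ (-(1 - α)) = (n:ℝ) ^ α / n := by
    rw [show -(1 - α) = α - 1 by ring, Real.rpow_sub hn0, Real.rpow_one]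
  rw [hn1, Real.rpow_neg hn0.le α]
  set N := (n:ℝ) ^ α
  set z := ζ n
  set l := lam ^ (-α)
  set k := kap α σ
  have hlA : 0 < lam - A := by linarith
  have hz : 0 < 1 - z := by linarith
  have eabs : |z * (b * N⁻¹) - (1 - z)| = |z * b - N * (1 - z)| / N := by
    rw [show z * (b * N⁻¹) - (1 - z) = (z * b - N * (1 - z)) / N by field_simp, abs_div,
      abs_of_pos hN]
  rw [eabs] at M
  have e1 : lam / n - A / n = (lam - A) / n := by ring
  rw [e1] at M
  generalize |z * b - N * (1 - z)| = w at M ⊢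
  generalize lam - A = y at M hlA ⊢
  generalize hu : 1 - z = u at M hz ⊢
  have M2 : (z - N * u * (k * l)) * X ≤ w * (k * l * (3 / b / y)) * (n * N) +
      z ^ 2 * (k * l * q) / (N * u) * N * N + z / lam * n := by
    calc (z - N * u * (k * l)) * X = z * X - u * (k * (l * N)) * X := by ring
      _ ≤ w / N * (k * (l * N)) * (3 / (b * N⁻¹) / (y / n)) + z * (k * (l * N)) * q * (z / u) +
          z / (lam / n) := by linarith
      _ = _ := by field_simp
  rw [← mul_div_assoc, div_le_iff₀ (by positivity)]
  refine M2.trans (le_of_eq ?_)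
  field_simp

theorem final (α σ b : ℝ) (hα : 0 < α) (hα1 : α < 1) (hσ : 0 < σ) (hb : 0 < b)
    (ζ : ℕ → ℝ) (hζ : ∀ n : ℕ, 1 ≤ n → ζ n ∈ Set.Ioo (0:ℝ) 1)
    (hlim : Tendsto (fun n : ℕ => (n : ℝ) ^ α * (1 - ζ n)) atTop (nhds b)) :
    TendstoUniformlyOn (fun (n : ℕ) t => wR α σ (ζ n) (n * t) / (n:ℝ) ^ α)
      (VR α σ b) atTop (Set.Ici 0) := by
  have hk := kap_pos hα1 hσ
  have hcast : Tendsto (fun n : ℕ => (n:ℝ)) atTop atTop := tendsto_natCast_atTop_atTop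
  have hNinv : Tendsto (fun n : ℕ => (n:ℝ) ^ (-α)) atTop (𝓝 0) :=
    (tendsto_rpow_neg_atTop hα).comp hcast
  have hNinv2 : Tendsto (fun n : ℕ => (n:ℝ) ^ (-(1 - α))) atTop (𝓝 0) :=
    (tendsto_rpow_neg_atTop (by linarith)).comp hcast
  have hζ1 : Tendsto ζ atTop (𝓝 1) := by
    have h := (hlim.mul hNinv).const_sub 1
    rw [mul_zero, sub_zero] at h
    refine h.congr' ?_
    filter_upwards [eventually_ge_atTop 1] with n hn
    have hn0 : (0:ℝ) < n := by exact_mod_cast hn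
    have : 0 < (n:ℝ) ^ α := by positivity
    rw [Real.rpow_neg hn0.le]
    field_simp
    ring
  -- choice of the weight
  obtain ⟨lam, hlam, hlamj⟩ : ∃ lam, (2 * (b * kap α σ)) ^ (1 / α) < lam ∧
      b * (kap α σ * lam ^ (-α)) < 1 := by
    have h1 : Tendsto (fun l : ℝ => b * (kap α σ * l ^ (-α))) atTop (𝓝 0) := by
      simpa using ((tendsto_rpow_neg_atTop hα).const_mul (kap α σ)).const_mul b
    exact ((eventually_gt_atTop _).and (h1.eventually_lt_const one_pos)).exists
  have hlam0 : 0 < lam := lt_of_le_of_lt (by positivity) hlam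
  set Y := Yf α σ b lam ζ with hYdef
  have hY : Tendsto Y atTop (𝓝 0) := by
    set j := kap α σ * lam ^ (-α)
    set C1 := j * (3 / b / (lam - (2 * (b * kap α σ)) ^ (1 / α)))
    set C2 := j * (∫⁻ x, up (QR α σ) x).toReal
    have hcoef : Tendsto (fun n : ℕ => ζ n - (n:ℝ) ^ α * (1 - ζ n) * j) atTop (𝓝 (1 - b * j)) :=
      hζ1.sub (hlim.mul_const j)
    have hpos : 0 < 1 - b * j := by linarith
    have hrhs : Tendsto (fun n : ℕ => |ζ n * b - (n:ℝ) ^ α * (1 - ζ n)| * C1 +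
        ζ n ^ 2 * C2 / ((n:ℝ) ^ α * (1 - ζ n)) * (n:ℝ) ^ (-(1 - α)) +
        ζ n / lam * (n:ℝ) ^ (-α)) atTop (𝓝 (|1 * b - b| * C1 + 1 ^ 2 * C2 / b * 0 + 1 / lam * 0)) :=
      ((((hζ1.mul_const b).sub hlim).abs.mul_const C1).add
        ((((hζ1.pow 2).mul_const C2).div hlim hb.ne').mul hNinv2)).add
        ((hζ1.div_const lam).mul hNinv)
    have hq := hrhs.div hcoef hpos.ne'
    rw [show (|1 * b - b| * C1 + 1 ^ 2 * C2 / b * 0 + 1 / lam * 0) / (1 - b * j) = 0 by simp] at hq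
    refine tendsto_of_tendsto_of_tendsto_of_le_of_le' tendsto_const_nhds hq ?_ ?_
    · refine Eventually.of_forall fun n => ?_
      simp only [hYdef, Yf]
      positivity
    · filter_upwards [eventually_ge_atTop 1, hcoef.eventually_const_lt hpos] with n hn hc
      simp only [Pi.div_apply]
      rw [le_div_iff₀ hc, mul_comm]
      exact Y_bound hα hα1 hσ hb hlam hn (hζ n hn)
  have hmono : ∀ᶠ n : ℕ in atTop,
      MonotoneOn (fun t => wR α σ (ζ n) (n * t) / (n:ℝ) ^ α) (Set.Ici 0) := by
    filter_upwards [eventually_ge_atTop 1] with n hn s _ t _ hst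
    simp only
    have := wR_mono hα hσ (hζ n hn).1 (hζ n hn).2 (show (n:ℝ) * s ≤ n * t by gcongr)
    gcongr
  have hUc := VR_continuous σ b hα
  have hpt : ∀ t, 0 ≤ t →
      Tendsto (fun n : ℕ => wR α σ (ζ n) (n * t) / (n:ℝ) ^ α) atTop (𝓝 (VR α σ b t)) := by
    refine ptwise (Un := fun (n : ℕ) t => wR α σ (ζ n) (n * t) / (n:ℝ) ^ α) (lam := lam)
      hmono hUc (VR_zero σ b hα) ?_ hY ?_
    · refine Eventually.of_forall fun n => ?_
      have := wR_nonneg (α := α) (σ := σ) (ζ := ζ n) (n * 0)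
      positivity
    · filter_upwards [eventually_ge_atTop 1] with n hn t0 t1 c ht0 ht01 hc h
      have hn0 : (0:ℝ) < n := by exact_mod_cast hn
      have hN : 0 < (n:ℝ) ^ α := by positivity
      have hs : (2 * (b * (n:ℝ) ^ (-α) * kap α σ)) ^ (1 / α) < lam / n := by
        rw [A_scale hα hk hb hn0]; gcongr
      have hb' : 0 < b * (n:ℝ) ^ (-α) := by positivity
      have hfin := wN_D_ne_top hα hα1 hσ (hζ n hn).1 (hζ n hn).2 hb' hs
      have L := lower_bound (T0 := n * t0) (T1 := n * t1) (c := c * (n:ℝ) ^ α)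
        hα hσ (hζ n hn).1 (hζ n hn).2 (by positivity) (by positivity)
        (by gcongr) (by positivity) hfin ?_
      · rw [hYdef, Yf, le_div_iff₀ (by positivity)]
        refine le_trans (le_of_eq ?_) L
        rw [show -(lam / n) * (n * t1) = -lam * t1 by field_simp]
        ring
      · intro T hT0 hT1
        have hTe : (n:ℝ) * (T / n) = T := by field_simp
        have h1 : t0 < T / n := by rw [lt_div_iff₀ hn0]; linarith
        have h2 : T / n < t1 := by rw [div_lt_iff₀ hn0]; linarith
        have := h (T / n) h1 h2
        have hV := VR_scale (α := α) (σ := σ) (b := b) hn0 (show 0 ≤ T / n by linarith)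
        rw [hTe] at this hV
        unfold DR
        rw [hV]
        have e : wR α σ (ζ n) T - (n:ℝ) ^ α * VR α σ b (T / n) =
            (wR α σ (ζ n) T / (n:ℝ) ^ α - VR α σ b (T / n)) * (n:ℝ) ^ α := by
          field_simp
        rw [e, abs_mul, abs_of_pos hN]
        gcongr
  have hm : Tendsto (fun n : ℕ => ζ n / ((n:ℝ) ^ α * (1 - ζ n))) atTop (𝓝 (1 / b)) :=
    hζ1.div hlim hb.ne'
  have hle : ∀ᶠ n : ℕ in atTop, ∀ t, 0 ≤ t →
      wR α σ (ζ n) (n * t) / (n:ℝ) ^ α ≤ ζ n / ((n:ℝ) ^ α * (1 - ζ n)) := by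
    filter_upwards [eventually_ge_atTop 1] with n hn t _
    have hn0 : (0:ℝ) < n := by exact_mod_cast hn
    have hN : 0 < (n:ℝ) ^ α := by positivity
    have := wR_le hα hσ (hζ n hn).1 (hζ n hn).2 (n * t)
    rw [mul_comm ((n:ℝ) ^ α) (1 - ζ n), ← div_div]
    gcongr
  have hUmono : MonotoneOn (VR α σ b) (Set.Ici 0) := by
    intro s hs t ht hst
    refine le_of_tendsto_of_tendsto (hpt s hs) (hpt t ht) ?_
    filter_upwards [hmono] with n hn
    exact hn hs ht hst
  have hUL : ∀ t, 0 ≤ t → VR α σ b t ≤ 1 / b := by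
    intro t ht
    refine le_of_tendsto_of_tendsto (hpt t ht) hm ?_
    filter_upwards [hle] with n hn
    exact hn t ht
  exact polya hmono hm hle hUc hUmono hUL hpt (VR_tail hα hα1 hσ hb hUmono hUL)

end RescaledResolvent


theorem convergence_of_rescaled_resolvent_integrals
    (α σ b : ℝ) (hα : α ∈ Set.Ioo (1/2 : ℝ) 1) (hσ : 0 < σ) (hb : 0 < b)
    (φ : ℝ → ℝ) (hφ : ∀ t : ℝ, φ t = α * σ * (1 + σ * t) ^ (-(α + 1)))
    (ζ : ℕ → ℝ) (hζ : ∀ n : ℕ, 1 ≤ n → ζ n ∈ Set.Ioo (0:ℝ) 1)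
    (R : ℕ → ℝ → ℝ) (hR : ∀ n : ℕ, ∀ t : ℝ, R n t = ∑' k : ℕ, ζ n ^ (k + 1) * convPow φ k t)
    (hlim : Tendsto (fun n : ℕ => (n : ℝ) ^ α * (1 - ζ n)) atTop (nhds b))
    (γ : ℝ) (hγ : γ = b * σ ^ α / Real.Gamma (1 - α)) :
    TendstoUniformlyOn
      (fun n : ℕ => fun t : ℝ => ∫ s in (0:ℝ)..t, (n : ℝ) ^ (1 - α) * R n ((n : ℝ) * s))
      (fun t : ℝ => mlCDF α γ t / b) atTop (Set.Ici 0) := by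
  obtain ⟨hα2, hα1⟩ := hα
  have hα0 : 0 < α := by linarith
  have hφ' : φ = RescaledResolvent.phiR α σ := funext hφ
  have hU : (fun t : ℝ => mlCDF α γ t / b) = RescaledResolvent.VR α σ b := by
    funext t
    unfold RescaledResolvent.VR RescaledResolvent.kap
    rw [hγ, mul_div_assoc]
  rw [hU]
  refine (RescaledResolvent.final α σ b hα0 hα1 hσ hb ζ hζ hlim).congr ?_
  filter_upwards [eventually_ge_atTop 1] with n hn t ht
  have hn0 : (0:ℝ) < n := by exact_mod_cast hn
  have ht0 : (0:ℝ) ≤ t := ht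
  have hW := RescaledResolvent.W_toReal hα0 hσ (hζ n hn).1 (hζ n hn).2
    (show (0:ℝ) ≤ n * t by positivity)
  have hR' : R n = fun y => ∑' k : ℕ, ζ n ^ (k + 1) * convPow (RescaledResolvent.phiR α σ) k y := by
    funext y
    rw [hR n y, hφ']
  simp only
  rw [intervalIntegral.integral_const_mul,
    intervalIntegral.integral_comp_mul_left (R n) hn0.ne', mul_zero, hR', hW, smul_eq_mul,
    Real.rpow_sub hn0, Real.rpow_one]
  unfold RescaledResolvent.wR
  field_simp
end

section
/- Let α ∈ (1/2,1), σ > 0, φ(t) = ασ(1+σt)^{-(α+1)} with tail Φ̄(t) = (1+σt)^{-α}, and for each n ≥ 1 let ζ_n ∈ (0,1), R_n(t) = ∑_{k=1}^∞ ζ_n^k φ^{*k}(t), and V_{n,0} ≥ 0. Assume n^α(1−ζ_n) → b > 0 and V_{n,0}/n^{2α−1} → V_*(0) ≥ 0 as n → ∞, and set γ = b σ^α / Γ(1−α) and V_0^{(n)}(t) = n^{1−2α} V_{n,0} ( Φ̄(nt) + (R_n*Φ̄)(nt) ). Then sup_{t ≥ 0} | V_0^{(n)}(t) − V_*(0)(1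 − F^{α,γ}(t)) | → 0 as n → ∞. -/
open MeasureTheory Real Filter Set

theorem lap_conv (f g : ℝ → ℝ) (z : ℝ)
    (hf : IntegrableOn (fun t => exp (-z * t) * f t) (Ioi 0))
    (hg : IntegrableOn (fun t => exp (-z * t) * g t) (Ioi 0)) :
    IntegrableOn (fun t => exp (-z * t) * conv g f t) (Ioi 0) ∧
    ∫ t in Ioi (0:ℝ), exp (-z * t) * conv g f t =
      (∫ t in Ioi (0:ℝ), exp (-z * t) * f t) * (∫ t in Ioi (0:ℝ), exp (-z * t) * g t) := by
  have key : ∀ x : ℝ, ∫ t in (0:ℝ)..x, (ContinuousLinearMap.mul ℝ ℝ) (exp (-z * t) * f t)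
      (exp (-z * (x - t)) * g (x - t)) = exp (-z * x) * conv g f x := by
    intro x
    rw [conv, ← intervalIntegral.integral_const_mul]
    congr 1
    ext t
    have : exp (-z * x) = exp (-z * t) * exp (-z * (x - t)) := by
      rw [← exp_add]; congr 1; ring
    rw [this]
    simp only [ContinuousLinearMap.mul_apply']
    ring
  constructor
  · have h := integrable_posConvolution (μ := volume) (ν := volume) hf hg (ContinuousLinearMap.mul ℝ ℝ)
    rw [posConvolution, integrable_indicator_iff measurableSet_Ioi] at h
    simpa only [key] using h
  · have h := integral_posConvolution (μ := volume) (ν := volume) hf hg (ContinuousLinearMap.mul ℝ ℝ)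
    simp only [key] at h
    rw [h]
    simp

/-- Standing assumptions on a bounded probability density. -/
structure IsDens (φ : ℝ → ℝ) (C : ℝ) : Prop where
  hm : Measurable φ
  h0 : ∀ t, 0 ≤ t → 0 ≤ φ t
  hC : ∀ t, 0 ≤ t → φ t ≤ C
  hi : IntegrableOn φ (Ioi 0)
  h1 : ∫ t in Ioi (0:ℝ), φ t = 1

theorem int_exp_mul {f : ℝ → ℝ} (hf : IntegrableOn f (Ioi 0)) {z : ℝ} (hz : 0 ≤ z) :
    IntegrableOn (fun t => exp (-z * t) * f t) (Ioi 0) := by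
  refine Integrable.mono hf ?_ ?_
  · exact (by fun_prop : Continuous fun t : ℝ => exp (-z * t)).aestronglyMeasurable.mul hf.1
  · filter_upwards [ae_restrict_mem measurableSet_Ioi] with t ht
    rw [norm_mul, norm_of_nonneg (exp_pos _).le]
    have : exp (-z * t) ≤ 1 := by
      rw [exp_le_one_iff]; nlinarith [mem_Ioi.1 ht]
    nlinarith [norm_nonneg (f t)]

theorem convPow_lap {φ : ℝ → ℝ} {C : ℝ} (h : IsDens φ C) {z : ℝ} (hz : 0 ≤ z) (k : ℕ) :
    IntegrableOn (fun t => exp (-z * t) * convPow φ k t) (Ioi 0) ∧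
    ∫ t in Ioi (0:ℝ), exp (-z * t) * convPow φ k t =
      (∫ t in Ioi (0:ℝ), exp (-z * t) * φ t) ^ (k + 1) := by
  induction k with
  | zero => simpa [convPow] using int_exp_mul h.hi hz
  | succ k ih =>
    have := lap_conv (convPow φ k) φ z ih.1 (int_exp_mul h.hi hz)
    refine ⟨this.1, ?_⟩
    rw [convPow, this.2, ih.2, pow_succ _ (k+1)]

theorem convPow_int {φ : ℝ → ℝ} {C : ℝ} (h : IsDens φ C) (k : ℕ) :
    IntegrableOn (convPow φ k) (Ioi 0) ∧ ∫ t in Ioi (0:ℝ), convPow φ k t = 1 := by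
  have := convPow_lap h le_rfl k
  simpa [h.h1] using this

theorem convPow_nonneg {φ : ℝ → ℝ} {C : ℝ} (h : IsDens φ C) (k : ℕ) :
    ∀ t, 0 ≤ t → 0 ≤ convPow φ k t := by
  induction k with
  | zero => exact h.h0
  | succ k ih =>
    intro t ht
    apply intervalIntegral.integral_nonneg ht
    intro s hs
    exact mul_nonneg (h.h0 _ (by linarith [hs.2])) (ih _ hs.1)

theorem convPow_le {φ : ℝ → ℝ} {C : ℝ} (h : IsDens φ C) (k : ℕ) :
    ∀ t, 0 ≤ t → convPow φ k t ≤ C := by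
  have hCC : 0 ≤ C := (h.h0 0 le_rfl).trans (h.hC 0 le_rfl)
  cases k with
  | zero => exact h.hC
  | succ k =>
    intro t ht
    rw [convPow, conv, intervalIntegral.integral_of_le ht]
    have hi := (convPow_int h k).1
    have hi' : IntegrableOn (convPow φ k) (Ioc 0 t) := hi.mono_set Ioc_subset_Ioi_self
    calc ∫ s in Ioc 0 t, φ (t - s) * convPow φ k s ≤ ∫ s in Ioc 0 t, C * convPow φ k s := by
          apply integral_mono_of_nonneg
          · filter_upwards [ae_restrict_mem measurableSet_Ioc] with s hs
            exact mul_nonneg (h.h0 _ (by linarith [hs.2])) (convPow_nonneg h k _ hs.1.le)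
          · exact hi'.const_mul C
          · filter_upwards [ae_restrict_mem measurableSet_Ioc] with s hs
            exact mul_le_mul_of_nonneg_right (h.hC _ (by linarith [hs.2])) (convPow_nonneg h k _ hs.1.le)
      _ = C * ∫ s in Ioc 0 t, convPow φ k s := integral_const_mul _ _
      _ ≤ C * ∫ s in Ioi 0, convPow φ k s := by
          apply mul_le_mul_of_nonneg_left _ hCC
          apply setIntegral_mono_set hi
          · filter_upwards [ae_restrict_mem measurableSet_Ioi] with s hs
            exact convPow_nonneg h k _ (le_of_lt hs)
          · exact Ioc_subset_Ioi_self.eventuallyLE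
      _ = C := by rw [(convPow_int h k).2, mul_one]

/-- The primitive of the convolution power. -/
noncomputable def primPow (φ : ℝ → ℝ) (k : ℕ) (x : ℝ) : ℝ := ∫ s in (0:ℝ)..x, convPow φ k s

theorem primPow_mono {φ : ℝ → ℝ} {C : ℝ} (h : IsDens φ C) (k : ℕ) :
    MonotoneOn (primPow φ k) (Ici 0) := by
  intro x hx y hy hxy
  rw [primPow, primPow, intervalIntegral.integral_of_le hx, intervalIntegral.integral_of_le hy]
  apply setIntegral_mono_set ((convPow_int h k).1.mono_set Ioc_subset_Ioi_self)
  · filter_upwards [ae_restrict_mem measurableSet_Ioc] with s hs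
    exact convPow_nonneg h k _ hs.1.le
  · exact (Ioc_subset_Ioc_right hxy).eventuallyLE

theorem primPow_nonneg {φ : ℝ → ℝ} {C : ℝ} (h : IsDens φ C) (k : ℕ) {x : ℝ} (hx : 0 ≤ x) :
    0 ≤ primPow φ k x :=
  intervalIntegral.integral_nonneg hx fun s hs => convPow_nonneg h k s hs.1

theorem primPow_le {φ : ℝ → ℝ} {C : ℝ} (h : IsDens φ C) (k : ℕ) {x : ℝ} (hx : 0 ≤ x) :
    primPow φ k x ≤ 1 := by
  rw [primPow, intervalIntegral.integral_of_le hx, ← (convPow_int h k).2]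
  apply setIntegral_mono_set ((convPow_int h k).1)
  · filter_upwards [ae_restrict_mem measurableSet_Ioi] with s hs
    exact convPow_nonneg h k _ (le_of_lt hs)
  · exact Ioc_subset_Ioi_self.eventuallyLE

theorem primPow_lap {φ : ℝ → ℝ} {C : ℝ} (h : IsDens φ C) {z : ℝ} (hz : 0 < z) (k : ℕ) :
    IntegrableOn (fun t => exp (-z * t) * primPow φ k t) (Ioi 0) ∧
    ∫ t in Ioi (0:ℝ), exp (-z * t) * primPow φ k t =
      (∫ t in Ioi (0:ℝ), exp (-z * t) * φ t) ^ (k + 1) / z := by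
  have h1 : IntegrableOn (fun t => exp (-z * t) * (fun _ : ℝ => (1:ℝ)) t) (Ioi 0) := by
    simpa using integrableOn_exp_mul_Ioi (neg_lt_zero.2 hz) 0
  have := lap_conv (convPow φ k) (fun _ => 1) z (convPow_lap h hz.le k).1 h1
  have e : conv (fun _ => 1) (convPow φ k) = primPow φ k := by
    ext x; simp [conv, primPow]
  rw [e] at this
  refine ⟨this.1, ?_⟩
  rw [this.2, (convPow_lap h hz.le k).2]
  simp only [mul_one]
  rw [integral_exp_mul_Ioi (neg_lt_zero.2 hz) 0]
  simp; field_simp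

theorem primPow_succ {φ : ℝ → ℝ} {C : ℝ} (h : IsDens φ C) (k : ℕ) {x : ℝ} (hx : 0 ≤ x) :
    primPow φ (k + 1) x = conv (convPow φ k) (fun y => ∫ u in (0:ℝ)..y, φ u) x := by
  have hq := (convPow_int h k).1
  have hp := h.hi
  set q := convPow φ k with hqdef
  rw [← integrable_indicator_iff measurableSet_Ioi] at hp hq
  have hIntg := hq.convolution_integrand (μ := volume) (ν := volume) (ContinuousLinearMap.mul ℝ ℝ) hp
  have hconv := posConvolution_eq_convolution_indicator q φ (ContinuousLinearMap.mul ℝ ℝ) volume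
  have e1 : primPow φ (k + 1) x = ∫ t in Iic x, ∫ s, (Ioi (0:ℝ)).indicator q s * (Ioi (0:ℝ)).indicator φ (t - s) := by
    have : ∀ t, ∫ s, (Ioi (0:ℝ)).indicator q s * (Ioi (0:ℝ)).indicator φ (t - s)
        = (Ioi (0:ℝ)).indicator (convPow φ (k+1)) t := by
      intro t
      have := congrFun hconv t
      rw [convolution, posConvolution] at this
      simp only [ContinuousLinearMap.mul_apply'] at this
      rw [← this]
      congr 1
      ext y
      rw [convPow, conv]
      congr 1
      ext s
      ring
    simp only [this]
    rw [setIntegral_indicator measurableSet_Ioi, primPow, intervalIntegral.integral_of_le hx]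
    congr 2
    ext t; simp [and_comm]
  rw [e1, integral_integral_swap]
  · have e2 : ∀ s, ∫ t in Iic x, (Ioi (0:ℝ)).indicator q s * (Ioi (0:ℝ)).indicator φ (t - s)
        = (Ioc (0:ℝ) x).indicator (fun s => q s * ∫ u in (0:ℝ)..(x - s), φ u) s := by
      intro s
      rw [integral_const_mul]
      by_cases hs : 0 < s
      · have e3 : ∫ t in Iic x, (Ioi (0:ℝ)).indicator φ (t - s) = ∫ t in Ioc s x, φ (t - s) := by
          have : (fun t => (Ioi (0:ℝ)).indicator φ (t - s)) = (Ioi s).indicator (fun t => φ (t - s)) := by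
            ext t; simp [indicator]
          rw [this, setIntegral_indicator measurableSet_Ioi]
          congr 2
          ext t; simp [and_comm]
        rw [e3]
        by_cases hsx : s ≤ x
        · rw [indicator_of_mem (show s ∈ Ioc 0 x from ⟨hs, hsx⟩), indicator_of_mem (show s ∈ Ioi 0 from hs),
            ← intervalIntegral.integral_of_le hsx, intervalIntegral.integral_comp_sub_right, sub_self]
        · rw [indicator_of_notMem (show s ∉ Ioc 0 x from fun h' => hsx h'.2), Ioc_eq_empty (by intro h'; exact hsx h'.le)]
          simp
      · rw [indicator_of_notMem (show s ∉ Ioc 0 x from fun h' => hs h'.1),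
          indicator_of_notMem (show s ∉ Ioi 0 from hs), zero_mul]
    simp only [e2]
    rw [integral_indicator measurableSet_Ioc, ← intervalIntegral.integral_of_le hx, conv]
    have := intervalIntegral.integral_comp_sub_left (a := 0) (b := x)
      (fun s => q s * ∫ u in (0:ℝ)..(x - s), φ u) x
    simp only [sub_sub_cancel, sub_self, sub_zero] at this
    exact this.symm
  · refine (hIntg.mono_measure ?_)
    exact Measure.prod_mono Measure.restrict_le_self le_rfl

theorem prim_eq {φ : ℝ → ℝ} (x : ℝ) : primPow φ 0 x = ∫ u in (0:ℝ)..x, φ u := rfl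

theorem conv_tail {φ Φbar : ℝ → ℝ} {C : ℝ} (h : IsDens φ C)
    (hΦ : ∀ t, 0 ≤ t → Φbar t = 1 - ∫ u in (0:ℝ)..t, φ u) (k : ℕ) {x : ℝ} (hx : 0 ≤ x) :
    IntervalIntegrable (fun s => convPow φ k (x - s) * Φbar s) volume 0 x ∧
    conv (convPow φ k) Φbar x = primPow φ k x - primPow φ (k + 1) x := by
  have hp : IntervalIntegrable (convPow φ k) volume 0 x :=
    (intervalIntegrable_iff_integrableOn_Ioc_of_le hx).2
      ((convPow_int h k).1.mono_set Ioc_subset_Ioi_self)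
  have hp1 : IntervalIntegrable φ volume 0 x :=
    (intervalIntegrable_iff_integrableOn_Ioc_of_le hx).2 (h.hi.mono_set Ioc_subset_Ioi_self)
  have hps : IntervalIntegrable (fun s => convPow φ k (x - s)) volume 0 x := by
    have := (hp.comp_sub_left x).symm
    simpa using this
  have hF : ContinuousOn (fun y => ∫ u in (0:ℝ)..y, φ u) (uIcc 0 x) := by
    apply intervalIntegral.continuousOn_primitive_interval
    exact (intervalIntegrable_iff' (by simp)).1 hp1
  have hpf : IntervalIntegrable (fun s => convPow φ k (x - s) * ∫ u in (0:ℝ)..s, φ u) volume 0 x :=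
    hps.mul_continuousOn hF
  have heq : ∀ s ∈ Icc 0 x, convPow φ k (x - s) * Φbar s =
      convPow φ k (x - s) - convPow φ k (x - s) * ∫ u in (0:ℝ)..s, φ u := by
    intro s hs
    rw [hΦ s hs.1]; ring
  constructor
  · refine (hps.sub hpf).congr ?_
    intro s hs
    rw [uIoc_of_le hx] at hs
    exact (heq s ⟨hs.1.le, hs.2⟩).symm
  · rw [primPow_succ h k hx, conv, conv, intervalIntegral.integral_congr (g := fun s =>
      convPow φ k (x - s) - convPow φ k (x - s) * ∫ u in (0:ℝ)..s, φ u)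
      (by rw [uIcc_of_le hx]; exact heq), intervalIntegral.integral_sub hps hpf]
    congr 1
    rw [intervalIntegral.integral_comp_sub_left (fun s => convPow φ k s) x]
    simp [primPow]

theorem sum_prim {φ : ℝ → ℝ} {C : ℝ} (h : IsDens φ C) {ζ : ℝ} (hζ : ζ ∈ Ioo (0:ℝ) 1)
    {x : ℝ} (hx : 0 ≤ x) : Summable (fun k : ℕ => ζ ^ k * primPow φ k x) := by
  refine Summable.of_nonneg_of_le (fun k => mul_nonneg (pow_nonneg hζ.1.le _) (primPow_nonneg h k hx))
    (fun k => ?_) (summable_geometric_of_lt_one hζ.1.le hζ.2)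
  exact mul_le_of_le_one_right (pow_nonneg hζ.1.le _) (primPow_le h k hx)

theorem U_formula {φ Φbar : ℝ → ℝ} {C : ℝ} (h : IsDens φ C)
    (hΦ : ∀ t, 0 ≤ t → Φbar t = 1 - ∫ u in (0:ℝ)..t, φ u) {ζ : ℝ} (hζ : ζ ∈ Ioo (0:ℝ) 1)
    (R : ℝ → ℝ) (hR : ∀ t, R t = ∑' k : ℕ, ζ ^ (k + 1) * convPow φ k t) {x : ℝ} (hx : 0 ≤ x) :
    Φbar x + conv R Φbar x = 1 - (1 - ζ) * ∑' k : ℕ, ζ ^ k * primPow φ k x := by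
  have hΦ0 : ∀ s, 0 ≤ s → 0 ≤ Φbar s := by
    intro s hs
    rw [hΦ s hs, ← prim_eq]
    linarith [primPow_le h 0 hs]
  have hnn : ∀ k, ∀ s ∈ Ioc 0 x, 0 ≤ ζ ^ (k+1) * (convPow φ k (x - s) * Φbar s) := by
    intro k s hs
    exact mul_nonneg (pow_nonneg hζ.1.le _) (mul_nonneg (convPow_nonneg h k _ (by linarith [hs.2]))
      (hΦ0 s hs.1.le))
  have hval : ∀ k : ℕ, ∫ s in Ioc 0 x, ζ ^ (k+1) * (convPow φ k (x - s) * Φbar s) =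
      ζ ^ (k+1) * (primPow φ k x - primPow φ (k + 1) x) := by
    intro k
    rw [integral_const_mul, ← (conv_tail h hΦ k hx).2, conv, intervalIntegral.integral_of_le hx]
  have hS := sum_prim h hζ hx
  have hS1 : Summable (fun k : ℕ => ζ ^ (k+1) * primPow φ k x) := by
    refine (hS.mul_left ζ).congr (fun k => ?_)
    rw [pow_succ]; ring
  have hS2 : Summable (fun k : ℕ => ζ ^ (k+1) * primPow φ (k+1) x) :=
    (summable_nat_add_iff (f := fun k : ℕ => ζ ^ k * primPow φ k x) 1).2 hS
  have hsum := hasSum_integral_of_summable_integral_norm (μ := volume.restrict (Ioc 0 x))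
    (F := fun (k : ℕ) s => ζ ^ (k+1) * (convPow φ k (x - s) * Φbar s))
    (fun k => (((intervalIntegrable_iff_integrableOn_Ioc_of_le hx).1 (conv_tail h hΦ k hx).1).const_mul _))
    (by
      refine ((hS1.sub hS2)).congr (fun k => ?_)
      rw [← mul_sub, ← hval k]
      apply setIntegral_congr_fun measurableSet_Ioc
      intro s hs
      exact (norm_of_nonneg (hnn k s hs)).symm)
  have hc : conv R Φbar x = ∫ s in Ioc 0 x, ∑' k : ℕ, ζ ^ (k+1) * (convPow φ k (x - s) * Φbar s) := by
    rw [conv, intervalIntegral.integral_of_le hx]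
    congr 1
    ext s
    rw [hR, ← tsum_mul_right]
    congr 1
    ext k
    ring
  rw [hc, ← hsum.tsum_eq]
  simp only [hval, mul_sub]
  rw [hS1.tsum_sub hS2]
  have e1 : ∑' k : ℕ, ζ ^ (k+1) * primPow φ k x = ζ * ∑' k : ℕ, ζ ^ k * primPow φ k x := by
    rw [← tsum_mul_left]
    congr 1; ext k; rw [pow_succ]; ring
  have e2 := hS.tsum_eq_zero_add
  rw [e1, hΦ x hx, ← prim_eq]
  simp only [pow_zero, one_mul] at e2
  linarith

/-- The renewal function. -/
noncomputable def renU (φ : ℝ → ℝ) (ζ x : ℝ) : ℝ := 1 - (1 - ζ) * ∑' k : ℕ, ζ ^ k * primPow φ k x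

theorem renU_anti {φ : ℝ → ℝ} {C : ℝ} (h : IsDens φ C) {ζ : ℝ} (hζ : ζ ∈ Ioo (0:ℝ) 1) :
    AntitoneOn (renU φ ζ) (Ici 0) := by
  intro x hx y hy hxy
  unfold renU
  have : ∑' k : ℕ, ζ ^ k * primPow φ k x ≤ ∑' k : ℕ, ζ ^ k * primPow φ k y :=
    Summable.tsum_le_tsum (fun k => mul_le_mul_of_nonneg_left (primPow_mono h k hx hy hxy)
      (pow_nonneg hζ.1.le _)) (sum_prim h hζ hx) (sum_prim h hζ hy)
  have h2 := hζ.2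
  nlinarith

theorem renU_nonneg {φ : ℝ → ℝ} {C : ℝ} (h : IsDens φ C) {ζ : ℝ} (hζ : ζ ∈ Ioo (0:ℝ) 1)
    {x : ℝ} (hx : 0 ≤ x) : 0 ≤ renU φ ζ x := by
  unfold renU
  have : ∑' k : ℕ, ζ ^ k * primPow φ k x ≤ ∑' k : ℕ, ζ ^ k :=
    Summable.tsum_le_tsum (fun k => mul_le_of_le_one_right (pow_nonneg hζ.1.le _) (primPow_le h k hx))
      (sum_prim h hζ hx) (summable_geometric_of_lt_one hζ.1.le hζ.2)
  rw [tsum_geometric_of_lt_one hζ.1.le hζ.2] at this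
  have h2 : 0 < 1 - ζ := by linarith [hζ.2]
  have h3 := mul_le_mul_of_nonneg_left this h2.le
  rw [mul_inv_cancel₀ h2.ne'] at h3
  linarith

theorem renU_le {φ : ℝ → ℝ} {C : ℝ} (h : IsDens φ C) {ζ : ℝ} (hζ : ζ ∈ Ioo (0:ℝ) 1)
    {x : ℝ} (hx : 0 ≤ x) : renU φ ζ x ≤ 1 := by
  unfold renU
  have : 0 ≤ ∑' k : ℕ, ζ ^ k * primPow φ k x :=
    tsum_nonneg fun k => mul_nonneg (pow_nonneg hζ.1.le _) (primPow_nonneg h k hx)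
  have h2 : 0 < 1 - ζ := by linarith [hζ.2]
  nlinarith

theorem lap_lt {φ : ℝ → ℝ} {C : ℝ} (h : IsDens φ C) {z : ℝ} (hz : 0 ≤ z) :
    0 ≤ ∫ t in Ioi (0:ℝ), exp (-z * t) * φ t ∧ ∫ t in Ioi (0:ℝ), exp (-z * t) * φ t ≤ 1 := by
  constructor
  · apply setIntegral_nonneg measurableSet_Ioi
    intro t ht
    exact mul_nonneg (exp_pos _).le (h.h0 t (le_of_lt ht))
  · rw [← h.h1]
    apply setIntegral_mono_on (int_exp_mul h.hi hz) h.hi measurableSet_Ioi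
    intro t ht
    apply mul_le_of_le_one_left (h.h0 t (le_of_lt ht))
    rw [exp_le_one_iff]; nlinarith [mem_Ioi.1 ht]

theorem renU_lap {φ : ℝ → ℝ} {C : ℝ} (h : IsDens φ C) {ζ : ℝ} (hζ : ζ ∈ Ioo (0:ℝ) 1)
    {z : ℝ} (hz : 0 < z) :
    IntegrableOn (fun t => exp (-z * t) * renU φ ζ t) (Ioi 0) ∧
    ∫ t in Ioi (0:ℝ), exp (-z * t) * renU φ ζ t =
      (1 - ∫ t in Ioi (0:ℝ), exp (-z * t) * φ t) /
        (z * (1 - ζ * ∫ t in Ioi (0:ℝ), exp (-z * t) * φ t)) := by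
  obtain ⟨hm0, hm1⟩ := lap_lt h hz.le
  have hpl := fun k => primPow_lap h hz k
  set m := ∫ t in Ioi (0:ℝ), exp (-z * t) * φ t with hm
  have hζm : ζ * m < 1 := by nlinarith [hζ.1, hζ.2]
  have hζm0 : 0 ≤ ζ * m := mul_nonneg hζ.1.le hm0
  have hE : IntegrableOn (fun t : ℝ => exp (-z * t)) (Ioi 0) := integrableOn_exp_mul_Ioi (neg_lt_zero.2 hz) 0
  have hE1 : ∫ t in Ioi (0:ℝ), exp (-z * t) = 1 / z := by
    rw [integral_exp_mul_Ioi (neg_lt_zero.2 hz) 0]; simp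
  have hval : ∀ k : ℕ, ∫ t in Ioi (0:ℝ), ζ ^ k * (exp (-z * t) * primPow φ k t) = m / z * (ζ * m) ^ k := by
    intro k
    rw [integral_const_mul, (hpl k).2, mul_pow, pow_succ]; ring
  have hgeo := (hasSum_geometric_of_lt_one hζm0 hζm).mul_left (m / z)
  have hsum := hasSum_integral_of_summable_integral_norm (μ := volume.restrict (Ioi 0))
    (F := fun (k : ℕ) t => ζ ^ k * (exp (-z * t) * primPow φ k t))
    (fun k => (hpl k).1.const_mul _)
    (by
      refine hgeo.summable.congr (fun k => ?_)
      rw [← hval k]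
      apply setIntegral_congr_fun measurableSet_Ioi
      intro s hs
      refine (norm_of_nonneg ?_).symm
      exact mul_nonneg (pow_nonneg hζ.1.le _) (mul_nonneg (exp_pos _).le (primPow_nonneg h k (le_of_lt hs))))
  simp only [hval] at hsum
  have hT : (fun t => ∑' k : ℕ, ζ ^ k * (exp (-z * t) * primPow φ k t)) =
      fun t => exp (-z * t) * ∑' k : ℕ, ζ ^ k * primPow φ k t := by
    ext t
    rw [← tsum_mul_left]
    congr 1; ext k; ring
  have hI := hsum.unique hgeo
  rw [hT] at hI
  have hUm : IntegrableOn (fun t => exp (-z * t) * renU φ ζ t) (Ioi 0) := by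
    refine Integrable.mono hE ?_ ?_
    · refine (by fun_prop : Continuous fun t : ℝ => exp (-z * t)).aestronglyMeasurable.mul ?_
      exact (aemeasurable_restrict_of_antitoneOn measurableSet_Ioi
        ((renU_anti h hζ).mono Ioi_subset_Ici_self)).aestronglyMeasurable
    · filter_upwards [ae_restrict_mem measurableSet_Ioi] with t ht
      rw [norm_mul, norm_of_nonneg (renU_nonneg h hζ (le_of_lt ht))]
      exact mul_le_of_le_one_right (norm_nonneg _) (renU_le h hζ (le_of_lt ht))
  refine ⟨hUm, ?_⟩
  have hsplit : (fun t => exp (-z * t) * ∑' k : ℕ, ζ ^ k * primPow φ k t) =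
      fun t => (1 - ζ)⁻¹ * (exp (-z * t) - exp (-z * t) * renU φ ζ t) := by
    ext t
    unfold renU
    have h2 : 1 - ζ ≠ 0 := by linarith [hζ.2]
    field_simp
    ring
  rw [hsplit, integral_const_mul, integral_sub hE hUm, hE1] at hI
  have h2 : 1 - ζ ≠ 0 := by linarith [hζ.2]
  have h3 : 1 - ζ * m ≠ 0 := by linarith
  have hI2 : 1 / z - ∫ t in Ioi (0:ℝ), exp (-z * t) * renU φ ζ t = (1 - ζ) * (m / z * (1 - ζ * m)⁻¹) := by
    rw [← hI]; field_simp
  have hI3 : ∫ t in Ioi (0:ℝ), exp (-z * t) * renU φ ζ t = 1 / z - (1 - ζ) * (m / z * (1 - ζ * m)⁻¹) := by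
    linarith
  rw [hI3]
  field_simp
  ring

theorem dens_deriv {α σ : ℝ} (hσ : 0 < σ) {t : ℝ} (ht : 0 ≤ t) :
    HasDerivAt (fun t : ℝ => -(1 + σ * t) ^ (-α)) (α * σ * (1 + σ * t) ^ (-(α + 1))) t := by
  have hpos : 0 < 1 + σ * t := by positivity
  have h1 : HasDerivAt (fun t : ℝ => 1 + σ * t) σ t := by
    simpa using ((hasDerivAt_id t).const_mul σ).const_add 1
  have h2 := (h1.rpow_const (p := -α) (Or.inl hpos.ne')).neg
  refine h2.congr_deriv ?_
  rw [show -α - 1 = -(α + 1) by ring]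
  ring

theorem dens_tail {α σ : ℝ} (hα : 0 < α) (hσ : 0 < σ) {φ Φbar : ℝ → ℝ}
    (hφ : ∀ t : ℝ, φ t = α * σ * (1 + σ * t) ^ (-(α + 1)))
    (hΦbar : ∀ t : ℝ, Φbar t = (1 + σ * t) ^ (-α)) :
    IsDens φ (α * σ) ∧ ∀ t, 0 ≤ t → Φbar t = 1 - ∫ u in (0:ℝ)..t, φ u := by
  have hφ' : φ = fun t => α * σ * (1 + σ * t) ^ (-(α + 1)) := funext hφ
  have hder : ∀ t ∈ Ici (0:ℝ), HasDerivAt (fun t : ℝ => -(1 + σ * t) ^ (-α)) (φ t) t := by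
    intro t ht
    rw [hφ]; exact dens_deriv hσ ht
  have h0 : ∀ t, 0 ≤ t → 0 ≤ φ t := by
    intro t ht; rw [hφ]; positivity
  have hlim : Tendsto (fun t : ℝ => -(1 + σ * t) ^ (-α)) atTop (nhds (-0)) := by
    apply Tendsto.neg
    apply (tendsto_rpow_neg_atTop hα).comp
    exact tendsto_atTop_add_const_left _ _ (tendsto_id.const_mul_atTop hσ)
  have hi : IntegrableOn φ (Ioi 0) :=
    integrableOn_Ioi_deriv_of_nonneg' hder (fun t ht => h0 t (le_of_lt ht)) hlim
  refine ⟨⟨?_, h0, ?_, hi, ?_⟩, ?_⟩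
  · rw [hφ']; fun_prop
  · intro t ht
    rw [hφ]
    apply mul_le_of_le_one_right (by positivity)
    apply rpow_le_one_of_one_le_of_nonpos
    · have : 0 ≤ σ * t := by positivity
      linarith
    · linarith
  · have := integral_Ioi_of_hasDerivAt_of_nonneg' hder (fun t ht => h0 t (le_of_lt ht)) hlim
    rw [this]; simp
  · intro t ht
    have := intervalIntegral.integral_eq_sub_of_hasDerivAt (a := 0) (b := t) (f := fun t : ℝ => -(1 + σ * t) ^ (-α)) (f' := φ)
      (by
        intro x hx
        rw [uIcc_of_le ht] at hx
        exact hder x hx.1)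
      ((intervalIntegrable_iff_integrableOn_Ioc_of_le ht).2 (hi.mono_set Ioc_subset_Ioi_self))
    rw [this, hΦbar]
    simp

theorem lap_tail {φ Φbar : ℝ → ℝ} {C : ℝ} (h : IsDens φ C)
    (hΦ : ∀ t, 0 ≤ t → Φbar t = 1 - ∫ u in (0:ℝ)..t, φ u) {z : ℝ} (hz : 0 < z) :
    1 - ∫ t in Ioi (0:ℝ), exp (-z * t) * φ t = z * ∫ t in Ioi (0:ℝ), exp (-z * t) * Φbar t := by
  have hp := primPow_lap h hz 0
  have hE : IntegrableOn (fun t : ℝ => exp (-z * t)) (Ioi 0) := integrableOn_exp_mul_Ioi (neg_lt_zero.2 hz) 0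
  have hE1 : ∫ t in Ioi (0:ℝ), exp (-z * t) = 1 / z := by
    rw [integral_exp_mul_Ioi (neg_lt_zero.2 hz) 0]; simp
  have e : ∫ t in Ioi (0:ℝ), exp (-z * t) * Φbar t =
      ∫ t in Ioi (0:ℝ), (exp (-z * t) - exp (-z * t) * primPow φ 0 t) := by
    apply setIntegral_congr_fun measurableSet_Ioi
    intro t ht
    simp only
    rw [hΦ t (le_of_lt ht), prim_eq]; ring
  rw [e, integral_sub hE hp.1, hp.2, hE1]
  field_simp
  ring

theorem int_s {α z : ℝ} (hα1 : α < 1) (hz : 0 < z) :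
    IntegrableOn (fun s : ℝ => exp (-z * s) * s ^ (-α)) (Ioi 0) := by
  have := integrableOn_rpow_mul_exp_neg_mul_rpow (p := 1) (s := -α) (b := z) (by linarith) one_pos hz
  refine this.congr_fun (fun s _ => ?_) measurableSet_Ioi
  simp [mul_comm]

theorem int_s_val {α z : ℝ} (hα1 : α < 1) (hz : 0 < z) :
    z * ∫ s in Ioi (0:ℝ), exp (-z * s) * s ^ (-α) = Real.Gamma (1 - α) * z ^ α := by
  have := Real.integral_rpow_mul_exp_neg_mul_Ioi (a := 1 - α) (r := z) (by linarith) hz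
  have e : ∫ s in Ioi (0:ℝ), exp (-z * s) * s ^ (-α) = (1 / z) ^ (1 - α) * Real.Gamma (1 - α) := by
    rw [← this]
    congr 1; ext s
    rw [mul_comm, show 1 - α - 1 = -α by ring, neg_mul]
  rw [e, one_div, inv_rpow hz.le, rpow_sub hz, rpow_one]
  have := (rpow_pos_of_pos hz α).ne'
  field_simp

/-- The scaled Laplace exponent. -/
noncomputable def scA (α : ℝ) (φ : ℝ → ℝ) (n : ℕ) (z : ℝ) : ℝ :=
  (n:ℝ) ^ α * (1 - ∫ t in Ioi (0:ℝ), exp (-(z / n) * t) * φ t)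

theorem scA_eq {α σ : ℝ} (hσ : 0 < σ) {φ Φbar : ℝ → ℝ}
    {C : ℝ} (h : IsDens φ C) (hΦ : ∀ t, 0 ≤ t → Φbar t = 1 - ∫ u in (0:ℝ)..t, φ u)
    (hΦbar : ∀ t : ℝ, Φbar t = (1 + σ * t) ^ (-α)) {n : ℕ} (hn : 1 ≤ n) {z : ℝ} (hz : 0 < z) :
    scA α φ n z = z * ∫ s in Ioi (0:ℝ), exp (-z * s) * (1 / n + σ * s) ^ (-α) := by
  have hn' : (0:ℝ) < n := by exact_mod_cast hn
  rw [scA, lap_tail h hΦ (div_pos hz hn')]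
  have := integral_comp_mul_left_Ioi (fun t => exp (-(z / n) * t) * Φbar t) 0 hn'
  rw [mul_zero, smul_eq_mul] at this
  have e : ∫ s in Ioi (0:ℝ), exp (-z * s) * (1 / n + σ * s) ^ (-α) =
      (n:ℝ) ^ α * ∫ x in Ioi (0:ℝ), exp (-(z / n) * (n * x)) * Φbar (n * x) := by
    rw [← integral_const_mul]
    apply setIntegral_congr_fun measurableSet_Ioi
    intro s hs
    have hs' : 0 < s := hs
    simp only
    rw [hΦbar, show -(z / n) * (n * s) = -z * s by field_simp,
      show 1 / (n:ℝ) + σ * s = (1 + σ * (n * s)) / n by field_simp,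
      div_rpow (by positivity) hn'.le, rpow_neg hn'.le α, div_inv_eq_mul]
    ring
  rw [e, this]
  field_simp

theorem scA_nonneg {α : ℝ} {φ : ℝ → ℝ} {C : ℝ} (h : IsDens φ C) (n : ℕ) {z : ℝ} (hz : 0 < z) :
    0 ≤ scA α φ n z := by
  refine mul_nonneg (by positivity) ?_
  linarith [(lap_lt h (z := z / n) (by positivity)).2]

theorem scA_integrand {α σ : ℝ} (hα : 0 < α) (hσ : 0 < σ) (n : ℕ) (z : ℝ) {s : ℝ} (hs : 0 < s) :
    exp (-z * s) * (1 / n + σ * s) ^ (-α) ≤ σ ^ (-α) * (exp (-z * s) * s ^ (-α)) := by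
  have : (1 / (n:ℝ) + σ * s) ^ (-α) ≤ (σ * s) ^ (-α) := by
    apply rpow_le_rpow_of_nonpos (by positivity) _ (by linarith)
    have : 0 ≤ 1 / (n:ℝ) := by positivity
    linarith
  rw [mul_rpow hσ.le hs.le] at this
  have := mul_le_mul_of_nonneg_left this (exp_pos (-z * s)).le
  linarith

theorem scA_le {α σ : ℝ} (hα : 0 < α) (hα1 : α < 1) (hσ : 0 < σ) {φ Φbar : ℝ → ℝ}
    {C : ℝ} (h : IsDens φ C) (hΦ : ∀ t, 0 ≤ t → Φbar t = 1 - ∫ u in (0:ℝ)..t, φ u)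
    (hΦbar : ∀ t : ℝ, Φbar t = (1 + σ * t) ^ (-α)) {n : ℕ} (hn : 1 ≤ n) {z : ℝ} (hz : 0 < z) :
    scA α φ n z ≤ σ ^ (-α) * Real.Gamma (1 - α) * z ^ α := by
  rw [scA_eq hσ h hΦ hΦbar hn hz, mul_assoc, ← int_s_val hα1 hz, mul_left_comm]
  apply mul_le_mul_of_nonneg_left _ hz.le
  rw [← integral_const_mul]
  apply integral_mono_of_nonneg
  · filter_upwards [ae_restrict_mem measurableSet_Ioi] with s hs
    have hs' : 0 < s := hs
    simp only [Pi.zero_apply]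
    positivity
  · exact (int_s hα1 hz).const_mul _
  · filter_upwards [ae_restrict_mem measurableSet_Ioi] with s hs
    exact scA_integrand hα hσ n z hs

theorem scA_lim {α σ : ℝ} (hα : 0 < α) (hα1 : α < 1) (hσ : 0 < σ) {φ Φbar : ℝ → ℝ}
    {C : ℝ} (h : IsDens φ C) (hΦ : ∀ t, 0 ≤ t → Φbar t = 1 - ∫ u in (0:ℝ)..t, φ u)
    (hΦbar : ∀ t : ℝ, Φbar t = (1 + σ * t) ^ (-α)) {z : ℝ} (hz : 0 < z) :
    Tendsto (fun n => scA α φ n z) atTop (nhds (σ ^ (-α) * Real.Gamma (1 - α) * z ^ α)) := by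
  have key : Tendsto (fun n : ℕ => z * ∫ s in Ioi (0:ℝ), exp (-z * s) * (1 / n + σ * s) ^ (-α)) atTop
      (nhds (z * ∫ s in Ioi (0:ℝ), σ ^ (-α) * (exp (-z * s) * s ^ (-α)))) := by
    apply Tendsto.const_mul
    apply tendsto_integral_of_dominated_convergence (fun s => σ ^ (-α) * (exp (-z * s) * s ^ (-α)))
    · intro n
      apply Measurable.aestronglyMeasurable
      fun_prop
    · exact (int_s hα1 hz).const_mul _
    · intro n
      filter_upwards [ae_restrict_mem measurableSet_Ioi] with s hs
      have hs' : 0 < s := hs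
      rw [norm_of_nonneg (by positivity)]
      exact scA_integrand hα hσ n z hs
    · filter_upwards [ae_restrict_mem measurableSet_Ioi] with s hs
      have hs' : 0 < s := hs
      rw [mul_left_comm, ← mul_rpow hσ.le hs'.le]
      apply Tendsto.const_mul
      have h1 : Tendsto (fun n : ℕ => 1 / (n:ℝ) + σ * s) atTop (nhds (0 + σ * s)) :=
        tendsto_one_div_atTop_nhds_zero_nat.add_const _
      rw [zero_add] at h1
      exact h1.rpow_const (Or.inl (by positivity))
  rw [integral_const_mul, mul_left_comm, int_s_val hα1 hz, ← mul_assoc] at key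
  refine key.congr' ?_
  filter_upwards [eventually_ge_atTop 1] with n hn
  exact (scA_eq hσ h hΦ hΦbar hn hz).symm

theorem scG_lap {α : ℝ} {φ : ℝ → ℝ} {C : ℝ} (h : IsDens φ C) {ζ : ℝ} (hζ : ζ ∈ Ioo (0:ℝ) 1)
    {n : ℕ} (hn : 1 ≤ n) {z : ℝ} (hz : 0 < z) :
    IntegrableOn (fun t => exp (-z * t) * renU φ ζ (n * t)) (Ioi 0) ∧
    ∫ t in Ioi (0:ℝ), exp (-z * t) * renU φ ζ (n * t) =
      scA α φ n z / (z * ((n:ℝ) ^ α * (1 - ζ) + ζ * scA α φ n z)) := by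
  have hn' : (0:ℝ) < n := by exact_mod_cast hn
  have hU := renU_lap h hζ (div_pos hz hn')
  have e : (fun t => exp (-z * t) * renU φ ζ (n * t)) =
      fun t => (fun t => exp (-(z / n) * t) * renU φ ζ t) (n * t) := by
    ext t
    simp only
    rw [show -(z / n) * (n * t) = -z * t by field_simp]
  constructor
  · rw [e, integrableOn_Ioi_comp_mul_left_iff (fun t => exp (-(z / n) * t) * renU φ ζ t) _ hn', mul_zero]
    exact hU.1
  · rw [e, integral_comp_mul_left_Ioi (fun t => exp (-(z / n) * t) * renU φ ζ t) _ hn', mul_zero, hU.2, scA, smul_eq_mul]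
    have hl := lap_lt h (div_pos hz hn').le
    set m := ∫ t in Ioi (0:ℝ), exp (-(z / n) * t) * φ t
    have h3 : 0 < 1 - ζ * m := by nlinarith [hζ.1, hζ.2, hl.1, hl.2]
    have h4 : (n:ℝ) ^ α * (1 - ζ) + ζ * ((n:ℝ) ^ α * (1 - m)) = (n:ℝ) ^ α * (1 - ζ * m) := by ring
    have h5 := (rpow_pos_of_pos hn' α).ne'
    rw [h4]
    field_simp

theorem gamma_lower {x T : ℝ} (hx : 0 ≤ x) (hT : 0 < T) : T ^ x * exp (-T) ≤ Real.Gamma (x + 1) := by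
  have hpos : 0 < x + 1 := by linarith
  have hIntg := Real.GammaIntegral_convergent hpos
  rw [Real.Gamma_eq_integral hpos]
  calc T ^ x * exp (-T) = ∫ s in Ioi T, T ^ x * exp (-s) := by
        rw [integral_const_mul, integral_exp_neg_Ioi]
    _ ≤ ∫ s in Ioi T, exp (-s) * s ^ (x + 1 - 1) := by
        apply setIntegral_mono_on ((integrableOn_exp_neg_Ioi T).const_mul _)
          (hIntg.mono_set (Ioi_subset_Ioi hT.le)) measurableSet_Ioi
        intro s hs
        rw [mul_comm, add_sub_cancel_right]
        exact mul_le_mul_of_nonneg_left (rpow_le_rpow hT.le (le_of_lt hs) hx) (exp_pos _).le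
    _ ≤ _ := by
        apply setIntegral_mono_set hIntg
        · filter_upwards [ae_restrict_mem measurableSet_Ioi] with s hs
          have hs' : 0 < s := hs
          simp only [Pi.zero_apply]
          positivity
        · exact (Ioi_subset_Ioi hT.le).eventuallyLE

theorem ml_gpos {α : ℝ} (hα : 0 < α) (m : ℕ) : 0 < Real.Gamma (α * m + 1) :=
  Real.Gamma_pos_of_pos (by positivity)

theorem ml_summable {α : ℝ} (hα : 0 < α) {y : ℝ} (hy : 0 ≤ y) :
    Summable (fun m : ℕ => y ^ m / Real.Gamma (α * m + 1)) := by
  set T := (2 * y + 1) ^ (1 / α) with hT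
  have hTp : 0 < T := by positivity
  have hTa : T ^ α = 2 * y + 1 := by
    rw [hT, ← rpow_mul (by positivity), one_div, inv_mul_cancel₀ hα.ne', rpow_one]
  refine Summable.of_nonneg_of_le (fun m => div_nonneg (pow_nonneg hy _) (ml_gpos hα m).le) (fun m => ?_)
    ((summable_geometric_of_lt_one (r := 1/2) (by norm_num) (by norm_num)).mul_left (exp T))
  rw [div_le_iff₀ (ml_gpos hα m)]
  have h1 := gamma_lower (x := α * m) (by positivity) hTp
  rw [rpow_mul hTp.le, hTa, rpow_natCast] at h1
  calc y ^ m ≤ (1/2) ^ m * (2 * y + 1) ^ m := by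
        rw [← mul_pow]; exact pow_le_pow_left₀ hy (by linarith) m
    _ = exp T * (1/2) ^ m * ((2 * y + 1) ^ m * exp (-T)) := by
        have : exp T * exp (-T) = 1 := by rw [← exp_add]; simp
        linear_combination (-((1/2) ^ m * (2 * y + 1) ^ m)) * this
    _ ≤ _ := by
        apply mul_le_mul_of_nonneg_left h1; positivity

theorem ml_continuous {α : ℝ} (hα : 0 < α) : Continuous (mittagLeffler α 1) := by
  rw [continuous_iff_continuousAt]
  intro x
  have hc : ContinuousOn (fun x => ∑' m : ℕ, x ^ m / Real.Gamma (α * m + 1)) (Icc (-(|x| + 1)) (|x| + 1)) := by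
    apply continuousOn_tsum (u := fun m : ℕ => (|x| + 1) ^ m / Real.Gamma (α * m + 1))
    · intro m; fun_prop
    · exact ml_summable hα (by positivity)
    · intro m y hy
      rw [norm_div, norm_pow, norm_of_nonneg (ml_gpos hα m).le]
      apply div_le_div_of_nonneg_right _ (ml_gpos hα m).le
      exact pow_le_pow_left₀ (norm_nonneg _) (abs_le.2 hy) m
  refine hc.continuousAt (Icc_mem_nhds ?_ ?_)
  · linarith [neg_abs_le x]
  · linarith [le_abs_self x]

theorem ml_lap {α : ℝ} (hα : 0 < α) {y z : ℝ} (hz : 0 < z) (hy : |y| < z ^ α) :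
    IntegrableOn (fun t => exp (-z * t) * mittagLeffler α 1 (y * t ^ α)) (Ioi 0) ∧
    ∫ t in Ioi (0:ℝ), exp (-z * t) * mittagLeffler α 1 (y * t ^ α) = z ^ α / (z * (z ^ α - y)) := by
  have hza : 0 < z ^ α := rpow_pos_of_pos hz α
  have hI : ∀ m : ℕ, IntegrableOn (fun t : ℝ => exp (-z * t) * t ^ (α * m)) (Ioi 0) := by
    intro m
    have h2 : (0:ℝ) ≤ α * m := by positivity
    have := integrableOn_rpow_mul_exp_neg_mul_rpow (p := 1) (s := α * m) (b := z) (by linarith) one_pos hz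
    refine this.congr_fun (fun s _ => ?_) measurableSet_Ioi
    simp [mul_comm]
  have hIv : ∀ m : ℕ, ∫ t in Ioi (0:ℝ), exp (-z * t) * t ^ (α * m) =
      (1 / z) * (1 / z ^ α) ^ m * Real.Gamma (α * m + 1) := by
    intro m
    have h2 : (0:ℝ) ≤ α * m := by positivity
    have := Real.integral_rpow_mul_exp_neg_mul_Ioi (a := α * m + 1) (r := z) (by linarith) hz
    have e : ∫ s in Ioi (0:ℝ), exp (-z * s) * s ^ (α * m) = (1 / z) ^ (α * m + 1) * Real.Gamma (α * m + 1) := by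
      rw [← this]
      congr 1; ext s
      rw [mul_comm, add_sub_cancel_right, neg_mul]
    rw [e, rpow_add (by positivity), rpow_one, rpow_mul (by positivity), rpow_natCast, one_div z,
      inv_rpow hz.le, ← one_div, ← one_div]
    ring
  have hF : ∀ (y : ℝ) (m : ℕ) , ∀ t ∈ Ioi (0:ℝ), exp (-z * t) * ((y * t ^ α) ^ m / Real.Gamma (α * m + 1)) =
      (y ^ m / Real.Gamma (α * m + 1)) * (exp (-z * t) * t ^ (α * m)) := by
    intro y m t ht
    rw [mul_pow, rpow_mul (le_of_lt ht), rpow_natCast]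
    ring
  have hval : ∀ (y : ℝ) (m : ℕ), ∫ t in Ioi (0:ℝ), exp (-z * t) * ((y * t ^ α) ^ m / Real.Gamma (α * m + 1)) =
      (1 / z) * (y / z ^ α) ^ m := by
    intro y m
    rw [setIntegral_congr_fun measurableSet_Ioi (hF y m), integral_const_mul, hIv, div_pow, div_pow, one_pow]
    have := (ml_gpos hα m).ne'
    field_simp
  have habs : |y / z ^ α| < 1 := by
    rw [abs_div, abs_of_pos hza, div_lt_one hza]; exact hy
  have hsum := hasSum_integral_of_summable_integral_norm (μ := volume.restrict (Ioi 0))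
    (F := fun (m : ℕ) t => exp (-z * t) * ((y * t ^ α) ^ m / Real.Gamma (α * m + 1)))
    (fun m => by
      refine IntegrableOn.congr_fun ((hI m).const_mul (y ^ m / Real.Gamma (α * m + 1))) ?_ measurableSet_Ioi
      intro t ht
      exact (hF y m t ht).symm)
    (by
      have hg := (summable_geometric_of_lt_one (abs_nonneg _) habs).mul_left (1 / z)
      refine hg.congr (fun m => ?_)
      rw [abs_div, abs_of_pos hza, ← hval |y| m]
      apply setIntegral_congr_fun measurableSet_Ioi
      intro t ht
      have ht' : 0 < t := ht
      simp only
      rw [norm_mul, norm_div, norm_pow, norm_mul, norm_of_nonneg (exp_pos _).le,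
        norm_of_nonneg (ml_gpos hα m).le, norm_of_nonneg (rpow_nonneg ht'.le _), Real.norm_eq_abs])
  simp only [hval, tsum_mul_left] at hsum
  have hg := (hasSum_geometric_of_abs_lt_one habs).mul_left (1 / z)
  have hv := hsum.unique hg
  have hpos : 0 < z ^ α - y := by linarith [(abs_lt.1 hy).2]
  have hv2 : ∫ t in Ioi (0:ℝ), exp (-z * t) * mittagLeffler α 1 (y * t ^ α) = z ^ α / (z * (z ^ α - y)) := by
    unfold mittagLeffler
    rw [hv]
    have : 1 - y / z ^ α = (z ^ α - y) / z ^ α := by field_simp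
    rw [this, inv_div]
    field_simp
  refine ⟨?_, hv2⟩
  by_contra hni
  rw [integral_undef hni] at hv2
  have : 0 < z ^ α / (z * (z ^ α - y)) := by positivity
  linarith

theorem w_int {w f : ℝ → ℝ} (hw : Continuous w) (hf : IntegrableOn f (Ioi 0)) :
    IntegrableOn (fun t => w (exp (-t)) * f t) (Ioi 0) := by
  obtain ⟨B, hB⟩ := isCompact_Icc.exists_bound_of_continuousOn (s := Icc (0:ℝ) 1) hw.continuousOn
  refine Integrable.bdd_mul (c := B) hf (by fun_prop : Continuous fun t => w (exp (-t))).aestronglyMeasurable ?_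
  filter_upwards [ae_restrict_mem measurableSet_Ioi] with t ht
  have ht' : 0 < t := ht
  exact hB _ ⟨(exp_pos _).le, by rw [exp_le_one_iff]; linarith⟩

theorem poly_lim {f : ℕ → ℝ → ℝ} {g : ℝ → ℝ} (hf : ∀ n, 1 ≤ n → IntegrableOn (f n) (Ioi 0))
    (hg : IntegrableOn g (Ioi 0))
    (hlim : ∀ k : ℕ, Tendsto (fun n => ∫ t in Ioi (0:ℝ), exp (-t) ^ k * f n t) atTop
      (nhds (∫ t in Ioi (0:ℝ), exp (-t) ^ k * g t))) (p : Polynomial ℝ) :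
    Tendsto (fun n => ∫ t in Ioi (0:ℝ), p.eval (exp (-t)) * f n t) atTop
      (nhds (∫ t in Ioi (0:ℝ), p.eval (exp (-t)) * g t)) := by
  induction p using Polynomial.induction_on' with
  | add p q hp hq =>
    have e : ∀ h : ℝ → ℝ, IntegrableOn h (Ioi 0) →
        ∫ t in Ioi (0:ℝ), (p + q).eval (exp (-t)) * h t =
        (∫ t in Ioi (0:ℝ), p.eval (exp (-t)) * h t) + ∫ t in Ioi (0:ℝ), q.eval (exp (-t)) * h t := by
      intro h hh
      rw [← integral_add (w_int p.continuous hh) (w_int q.continuous hh)]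
      congr 1; ext t
      rw [Polynomial.eval_add, add_mul]
    rw [e g hg]
    refine (hp.add hq).congr' ?_
    filter_upwards [eventually_ge_atTop 1] with n hn
    exact (e _ (hf n hn)).symm
  | monomial k a =>
    have e : ∀ h : ℝ → ℝ, ∫ t in Ioi (0:ℝ), (Polynomial.monomial k a).eval (exp (-t)) * h t =
        a * ∫ t in Ioi (0:ℝ), exp (-t) ^ k * h t := by
      intro h
      rw [← integral_const_mul]
      congr 1; ext t
      rw [Polynomial.eval_monomial, mul_assoc]
    simp only [e]
    exact (hlim k).const_mul a

theorem cont_lim {f : ℕ → ℝ → ℝ} {g : ℝ → ℝ} (hf : ∀ n, 1 ≤ n → IntegrableOn (f n) (Ioi 0))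
    (hg : IntegrableOn g (Ioi 0)) {M : ℝ} (hM : ∀ n, 1 ≤ n → ∫ t in Ioi (0:ℝ), |f n t| ≤ M)
    (hlim : ∀ k : ℕ, Tendsto (fun n => ∫ t in Ioi (0:ℝ), exp (-t) ^ k * f n t) atTop
      (nhds (∫ t in Ioi (0:ℝ), exp (-t) ^ k * g t))) {w : ℝ → ℝ} (hw : Continuous w) :
    Tendsto (fun n => ∫ t in Ioi (0:ℝ), w (exp (-t)) * f n t) atTop
      (nhds (∫ t in Ioi (0:ℝ), w (exp (-t)) * g t)) := by
  have hM0 : 0 ≤ M := (integral_nonneg fun t => abs_nonneg _).trans (hM 1 le_rfl)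
  set N := ∫ t in Ioi (0:ℝ), |g t| with hN
  have hN0 : 0 ≤ N := integral_nonneg fun t => abs_nonneg _
  rw [Metric.tendsto_atTop]
  intro ε hε
  set η := ε / (2 * (M + N + 1)) with hη
  have hη0 : 0 < η := by positivity
  obtain ⟨p, hp⟩ := exists_polynomial_near_of_continuousOn 0 1 w hw.continuousOn η hη0
  have hd : ∀ h : ℝ → ℝ, IntegrableOn h (Ioi 0) →
      |(∫ t in Ioi (0:ℝ), w (exp (-t)) * h t) - ∫ t in Ioi (0:ℝ), p.eval (exp (-t)) * h t| ≤
        η * ∫ t in Ioi (0:ℝ), |h t| := by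
    intro h hh
    rw [← integral_sub (w_int hw hh) (w_int p.continuous hh), ← integral_const_mul, ← Real.norm_eq_abs]
    apply norm_integral_le_of_norm_le (hh.abs.const_mul η)
    filter_upwards [ae_restrict_mem measurableSet_Ioi] with t ht
    have ht' : 0 < t := ht
    rw [← sub_mul, norm_mul, Real.norm_eq_abs, Real.norm_eq_abs, abs_sub_comm]
    apply mul_le_mul_of_nonneg_right _ (abs_nonneg _)
    exact (hp _ ⟨(exp_pos _).le, by rw [exp_le_one_iff]; linarith⟩).le
  obtain ⟨n0, hn0⟩ := Metric.tendsto_atTop.1 (poly_lim hf hg hlim p) (ε / 2) (by positivity)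
  refine ⟨max n0 1, fun n hn => ?_⟩
  have h1 := hn0 n ((le_max_left _ _).trans hn)
  have hn1 : 1 ≤ n := (le_max_right _ _).trans hn
  have h2 := hd _ (hf n hn1)
  have h3 := hd g hg
  have h4 : η * (∫ t in Ioi (0:ℝ), |f n t|) ≤ η * M := mul_le_mul_of_nonneg_left (hM n hn1) hη0.le
  have h5 : η * M + η * N < ε / 2 := by
    have : η * (M + N + 1) = ε / 2 := by rw [hη]; field_simp
    nlinarith
  rw [Real.dist_eq] at h1 ⊢
  rw [abs_lt] at h1 ⊢
  rw [abs_le] at h2 h3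
  rw [← hN] at h3
  constructor <;> linarith [h1.1, h1.2, h2.1, h2.2, h3.1, h3.2]

theorem anti_pointwise {g : ℕ → ℝ → ℝ} {G : ℝ → ℝ} {z : ℝ} (hz : 0 < z)
    (hanti : ∀ n, 1 ≤ n → AntitoneOn (g n) (Ici 0))
    (h0 : ∀ n, 1 ≤ n → ∀ t, 0 ≤ t → 0 ≤ g n t) (h1 : ∀ n, 1 ≤ n → ∀ t, 0 ≤ t → g n t ≤ 1)
    (hgi : ∀ n, 1 ≤ n → IntegrableOn (fun t => exp (-z * t) * g n t) (Ioi 0))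
    (hG : Continuous G) (hGi : IntegrableOn (fun t => exp (-z * t) * G t) (Ioi 0))
    (hlim : ∀ k : ℕ, Tendsto (fun n => ∫ t in Ioi (0:ℝ), exp (-(z + k) * t) * g n t) atTop
      (nhds (∫ t in Ioi (0:ℝ), exp (-(z + k) * t) * G t))) {t : ℝ} (ht : 0 < t) :
    Tendsto (fun n => g n t) atTop (nhds (G t)) := by
  have hE : IntegrableOn (fun t : ℝ => exp (-z * t)) (Ioi 0) := integrableOn_exp_mul_Ioi (neg_lt_zero.2 hz) 0
  have hlim' : ∀ w : ℝ → ℝ, Continuous w →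
      Tendsto (fun n => ∫ t in Ioi (0:ℝ), w (exp (-t)) * (exp (-z * t) * g n t)) atTop
      (nhds (∫ t in Ioi (0:ℝ), w (exp (-t)) * (exp (-z * t) * G t))) := by
    intro w hw
    refine cont_lim (M := ∫ t in Ioi (0:ℝ), exp (-z * t)) hgi hGi ?_ ?_ hw
    · intro n hn
      apply setIntegral_mono_on (hgi n hn).abs hE measurableSet_Ioi
      intro s hs
      rw [abs_mul, abs_of_pos (exp_pos _), abs_of_nonneg (h0 n hn s (le_of_lt hs))]
      exact mul_le_of_le_one_right (exp_pos _).le (h1 n hn s (le_of_lt hs))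
    · intro k
      have e : ∀ s : ℝ, exp (-(z + k) * s) = exp (-s) ^ k * exp (-z * s) := by
        intro s
        rw [← exp_nat_mul, ← exp_add]; congr 1; ring
      have := hlim k
      simp only [e, mul_assoc] at this
      exact this
  have main : ∀ a b : ℝ, 0 ≤ a → a < b → ∃ w : ℝ → ℝ, Continuous w ∧ (∀ x, 0 ≤ w x) ∧
      (∀ s, s ∉ Icc a b → w (exp (-s)) = 0) ∧ 0 < ∫ s in Ioi (0:ℝ), w (exp (-s)) * exp (-z * s) := by
    intro a b ha hab
    refine ⟨fun x => max 0 (min (x - exp (-b)) (exp (-a) - x)), by fun_prop, fun x => le_max_left _ _, ?_, ?_⟩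
    · intro s hs
      apply max_eq_left
      by_cases h : s < a
      · apply (min_le_right _ _).trans
        have : exp (-a) ≤ exp (-s) := exp_le_exp.2 (by linarith)
        linarith
      · have hb : b < s := by
          by_contra hb
          exact hs ⟨not_lt.1 h, not_lt.1 hb⟩
        apply (min_le_left _ _).trans
        have : exp (-s) ≤ exp (-b) := exp_le_exp.2 (by linarith)
        linarith
    · have hc : Continuous fun s : ℝ => max 0 (min (exp (-s) - exp (-b)) (exp (-a) - exp (-s))) * exp (-z * s) := by
        fun_prop
      have hp := intervalIntegral.intervalIntegral_pos_of_pos_on (a := a) (b := b)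
        (hc.intervalIntegrable a b) (by
          intro s hs
          apply mul_pos _ (exp_pos _)
          apply lt_max_of_lt_right
          apply lt_min
          · have : exp (-b) < exp (-s) := exp_lt_exp.2 (by linarith [hs.2])
            linarith
          · have : exp (-s) < exp (-a) := exp_lt_exp.2 (by linarith [hs.1])
            linarith) hab
      rw [intervalIntegral.integral_of_le hab.le] at hp
      refine hp.trans_le ?_
      apply setIntegral_mono_set
      · exact w_int (w := fun x => max 0 (min (x - exp (-b)) (exp (-a) - x))) (by fun_prop) hE
      · filter_upwards with s
        exact mul_nonneg (le_max_left _ _) (exp_pos _).le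
      · exact HasSubset.Subset.eventuallyLE (fun s hs => lt_of_le_of_lt ha hs.1)
  have cmp : ∀ (w u v : ℝ → ℝ) (a b : ℝ), Continuous w → (∀ x, 0 ≤ w x) →
      (∀ s, s ∉ Icc a b → w (exp (-s)) = 0) →
      IntegrableOn (fun t => exp (-z * t) * u t) (Ioi 0) → IntegrableOn (fun t => exp (-z * t) * v t) (Ioi 0) →
      (∀ s ∈ Icc a b, 0 < s → u s ≤ v s) →
      ∫ s in Ioi (0:ℝ), w (exp (-s)) * (exp (-z * s) * u s) ≤
        ∫ s in Ioi (0:ℝ), w (exp (-s)) * (exp (-z * s) * v s) := by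
    intro w u v a b hw hw0 hws hu hv huv
    apply setIntegral_mono_on (w_int hw hu) (w_int hw hv) measurableSet_Ioi
    intro s hs
    by_cases h : s ∈ Icc a b
    · exact mul_le_mul_of_nonneg_left (mul_le_mul_of_nonneg_left (huv s h hs) (exp_pos _).le) (hw0 _)
    · rw [hws s h]; simp
  have cst : ∀ (w : ℝ → ℝ) (c : ℝ), ∫ s in Ioi (0:ℝ), w (exp (-s)) * (exp (-z * s) * c) =
      (∫ s in Ioi (0:ℝ), w (exp (-s)) * exp (-z * s)) * c := by
    intro w c
    rw [← integral_mul_const]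
    congr 1; ext s; ring
  have hEc : ∀ c : ℝ, IntegrableOn (fun t : ℝ => exp (-z * t) * c) (Ioi 0) := fun c => hE.mul_const c
  rw [Metric.tendsto_nhds]
  intro ε hε
  obtain ⟨δ, hδ, hδG⟩ := Metric.continuousAt_iff.1 (hG.continuousAt (x := t)) (ε / 2) (by positivity)
  set d := min (δ / 2) t with hd
  have hd0 : 0 < d := by positivity
  have hdδ : d < δ := (min_le_left _ _).trans_lt (by linarith)
  have hdt : d ≤ t := min_le_right _ _
  have hnear : ∀ s, |s - t| ≤ d → |G s - G t| < ε / 2 := by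
    intro s hs
    have := hδG (x := s) (by rw [Real.dist_eq]; linarith)
    rwa [Real.dist_eq] at this
  have up : ∀ᶠ n in atTop, g n t < G t + ε := by
    obtain ⟨w, hw, hw0, hws, hW⟩ := main (t - d) t (by linarith) (by linarith)
    have hb : ∫ s in Ioi (0:ℝ), w (exp (-s)) * (exp (-z * s) * G s) ≤
        (∫ s in Ioi (0:ℝ), w (exp (-s)) * exp (-z * s)) * (G t + ε / 2) := by
      rw [← cst]
      refine cmp w G (fun _ => G t + ε / 2) (t - d) t hw hw0 hws hGi (hEc _) ?_
      intro s hs _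
      have := abs_lt.1 (hnear s (abs_le.2 ⟨by linarith [hs.1], by linarith [hs.2]⟩))
      linarith [this.2]
    have hlt : ∫ s in Ioi (0:ℝ), w (exp (-s)) * (exp (-z * s) * G s) <
        (∫ s in Ioi (0:ℝ), w (exp (-s)) * exp (-z * s)) * (G t + ε) :=
      hb.trans_lt (mul_lt_mul_of_pos_left (by linarith) hW)
    filter_upwards [(hlim' w hw).eventually_lt_const hlt, eventually_ge_atTop 1] with n hn hn1
    have hc := cmp w (fun _ => g n t) (g n) (t - d) t hw hw0 hws (hEc _) (hgi n hn1)
      (fun s hs hs0 => hanti n hn1 (le_of_lt hs0) ht.le hs.2)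
    rw [cst] at hc
    exact lt_of_mul_lt_mul_left (hc.trans_lt hn) hW.le
  have low : ∀ᶠ n in atTop, G t - ε < g n t := by
    obtain ⟨w, hw, hw0, hws, hW⟩ := main t (t + d) ht.le (by linarith)
    have hb : (∫ s in Ioi (0:ℝ), w (exp (-s)) * exp (-z * s)) * (G t - ε / 2) ≤
        ∫ s in Ioi (0:ℝ), w (exp (-s)) * (exp (-z * s) * G s) := by
      rw [← cst]
      refine cmp w (fun _ => G t - ε / 2) G t (t + d) hw hw0 hws (hEc _) hGi ?_
      intro s hs _
      have := abs_lt.1 (hnear s (abs_le.2 ⟨by linarith [hs.1], by linarith [hs.2]⟩))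
      linarith [this.1]
    have hlt : (∫ s in Ioi (0:ℝ), w (exp (-s)) * exp (-z * s)) * (G t - ε) <
        ∫ s in Ioi (0:ℝ), w (exp (-s)) * (exp (-z * s) * G s) :=
      (mul_lt_mul_of_pos_left (by linarith) hW).trans_le hb
    filter_upwards [(hlim' w hw).eventually_const_lt hlt, eventually_ge_atTop 1] with n hn hn1
    have hc := cmp w (g n) (fun _ => g n t) t (t + d) hw hw0 hws (hgi n hn1) (hEc _)
      (fun s hs hs0 => hanti n hn1 ht.le (le_of_lt hs0) hs.1)
    rw [cst] at hc
    exact lt_of_mul_lt_mul_left (hn.trans_le hc) hW.le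
  filter_upwards [up, low] with n h1 h2
  rw [Real.dist_eq, abs_lt]
  constructor <;> linarith

theorem polya {g : ℕ → ℝ → ℝ} {G : ℝ → ℝ}
    (hanti : ∀ n, 1 ≤ n → AntitoneOn (g n) (Ici 0))
    (h0 : ∀ n, 1 ≤ n → ∀ t, 0 ≤ t → 0 ≤ g n t) (hG : Continuous G)
    (hlim : ∀ t, 0 ≤ t → Tendsto (fun n => g n t) atTop (nhds (G t)))
    (hG0 : Tendsto G atTop (nhds 0)) :
    TendstoUniformlyOn g G atTop (Ici 0) := by
  have hGanti : AntitoneOn G (Ici 0) := by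
    intro x hx y hy hxy
    refine le_of_tendsto_of_tendsto (hlim y hy) (hlim x hx) ?_
    filter_upwards [eventually_ge_atTop 1] with n hn
    exact hanti n hn hx hy hxy
  have hGnn : ∀ t, 0 ≤ t → 0 ≤ G t := by
    intro t ht
    refine ge_of_tendsto (hlim t ht) ?_
    filter_upwards [eventually_ge_atTop 1] with n hn
    exact h0 n hn t ht
  have hcpt : ∀ T, TendstoUniformlyOn g G atTop (Icc 0 T) := by
    intro T
    rw [← tendstoLocallyUniformlyOn_iff_tendstoUniformlyOn_of_compact isCompact_Icc,
      Metric.tendstoLocallyUniformlyOn_iff]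
    intro ε hε x hx
    obtain ⟨δ, hδ, hδG⟩ := Metric.continuousAt_iff.1 (hG.continuousAt (x := x)) (ε / 4) (by positivity)
    set a := max (x - δ / 2) 0 with ha
    have ha0 : 0 ≤ a := le_max_right _ _
    have hax : a ≤ x := max_le (by linarith) hx.1
    have hax' : x - δ / 2 ≤ a := le_max_left _ _
    have hnear : ∀ s, |s - x| ≤ δ / 2 → |G s - G x| < ε / 4 := by
      intro s hs
      have := hδG (x := s) (by rw [Real.dist_eq]; linarith)
      rwa [Real.dist_eq] at this
    have hb0 : 0 ≤ x + δ / 2 := by linarith [hx.1]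
    refine ⟨Icc (x - δ / 2) (x + δ / 2) ∩ Icc 0 T, ?_, ?_⟩
    · rw [inter_comm]
      exact inter_mem_nhdsWithin _ (Icc_mem_nhds (by linarith) (by linarith))
    · have ea := Metric.tendsto_nhds.1 (hlim a ha0) (ε / 4) (by positivity)
      have eb := Metric.tendsto_nhds.1 (hlim (x + δ / 2) hb0) (ε / 4) (by positivity)
      filter_upwards [ea, eb, eventually_ge_atTop 1] with n hna hnb hn y hy
      have hya : a ≤ y := max_le hy.1.1 hy.2.1
      have k1 := hanti n hn ha0 hy.2.1 hya
      have k2 := hanti n hn hy.2.1 hb0 hy.1.2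
      have n1 := abs_lt.1 (hnear a (abs_le.2 ⟨by linarith, by linarith⟩))
      have n2 := abs_lt.1 (hnear (x + δ / 2) (abs_le.2 ⟨by linarith, by linarith⟩))
      have n3 := abs_lt.1 (hnear y (abs_le.2 ⟨by linarith [hy.1.1], by linarith [hy.1.2]⟩))
      rw [Real.dist_eq, abs_lt] at hna hnb ⊢
      constructor <;> linarith [hna.1, hna.2, hnb.1, hnb.2, n1.1, n1.2, n2.1, n2.2, n3.1, n3.2]
  rw [Metric.tendstoUniformlyOn_iff]
  intro ε hε
  obtain ⟨T, hT⟩ := (((hG0.eventually_lt_const (show (0:ℝ) < ε / 2 by positivity))).and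
    (eventually_ge_atTop 0)).exists
  have eT := Metric.tendsto_nhds.1 (hlim T hT.2) (ε / 2) (by positivity)
  filter_upwards [Metric.tendstoUniformlyOn_iff.1 (hcpt T) ε hε, eT, eventually_ge_atTop 1] with n h1 h2 hn t ht
  by_cases htT : t ≤ T
  · exact h1 t ⟨ht, htT⟩
  · push Not at htT
    have k1 := hanti n hn hT.2 ht htT.le
    have k2 := hGanti hT.2 ht htT.le
    have k3 := h0 n hn t ht
    have k4 := hGnn t ht
    have k5 := hT.1
    rw [Real.dist_eq, abs_lt] at h2 ⊢
    constructor <;> linarith [h2.1, h2.2]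

theorem anti_markov {g : ℝ → ℝ} (ha : AntitoneOn g (Ici 0)) (h0 : ∀ t, 0 ≤ t → 0 ≤ g t) {t : ℝ} (ht : 0 < t)
    (hi : IntegrableOn (fun s => exp (-(1 / t) * s) * g s) (Ioi 0)) :
    t * (exp (-1) * g t) ≤ ∫ s in Ioi (0:ℝ), exp (-(1 / t) * s) * g s := by
  have hsub : Ioc 0 t ⊆ Ioi (0:ℝ) := fun x hx => hx.1
  calc t * (exp (-1) * g t) = ∫ s in Ioc 0 t, exp (-1) * g t := by
        rw [setIntegral_const]; simp [ht.le, Measure.real]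
    _ ≤ ∫ s in Ioc 0 t, exp (-(1 / t) * s) * g s := by
        apply setIntegral_mono_on _ (hi.mono_set hsub) measurableSet_Ioc
        · intro s hs
          have e1 : exp (-1) ≤ exp (-(1 / t) * s) := by
            apply exp_le_exp.2
            have : s / t ≤ 1 := (div_le_one ht).2 hs.2
            have e : -(1 / t) * s = - (s / t) := by ring
            rw [e]; linarith
          exact mul_le_mul e1 (ha (mem_Ici.2 hs.1.le) (mem_Ici.2 ht.le) hs.2) (h0 t ht.le) (exp_pos _).le
        · exact integrableOn_const (by simp)
    _ ≤ _ := by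
        apply setIntegral_mono_set hi
        · filter_upwards [self_mem_ae_restrict measurableSet_Ioi] with s hs
          exact mul_nonneg (exp_pos _).le (h0 s (le_of_lt hs))
        · exact Filter.Eventually.of_forall hsub

theorem renU_zero (φ : ℝ → ℝ) (ζ : ℝ) : renU φ ζ 0 = 1 := by
  simp [renU, primPow]

theorem ml_zero (α : ℝ) : mittagLeffler α 1 0 = 1 := by
  unfold mittagLeffler
  rw [tsum_eq_single 0]
  · simp
  · intro m hm; simp [hm]

theorem main_core {α σ b : ℝ} (hα : 0 < α) (hα1 : α < 1) (hσ : 0 < σ) (hb : 0 < b)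
    {φ : ℝ → ℝ} (hφ : ∀ t : ℝ, φ t = α * σ * (1 + σ * t) ^ (-(α + 1)))
    {Φbar : ℝ → ℝ} (hΦbar : ∀ t : ℝ, Φbar t = (1 + σ * t) ^ (-α))
    {ζ : ℕ → ℝ} (hζ : ∀ n : ℕ, 1 ≤ n → ζ n ∈ Set.Ioo (0:ℝ) 1)
    (hζlim : Tendsto (fun n : ℕ => (n : ℝ) ^ α * (1 - ζ n)) atTop (nhds b))
    {γ : ℝ} (hγ : γ = b * σ ^ α / Real.Gamma (1 - α)) :
    TendstoUniformlyOn (fun n : ℕ => fun t : ℝ => renU φ (ζ n) (n * t))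
      (fun t : ℝ => mittagLeffler α 1 (-γ * t ^ α)) atTop (Set.Ici 0) := by
  obtain ⟨h, hΦ⟩ := dens_tail hα hσ hφ hΦbar
  have hΓ : 0 < Real.Gamma (1 - α) := Real.Gamma_pos_of_pos (by linarith)
  obtain ⟨c, hc⟩ : ∃ c, c = σ ^ (-α) * Real.Gamma (1 - α) := ⟨_, rfl⟩
  have hcpos : 0 < c := by rw [hc]; exact mul_pos (rpow_pos_of_pos hσ _) hΓ
  have hγc : γ * c = b := by
    rw [hγ, hc, rpow_neg hσ.le]
    have := (rpow_pos_of_pos hσ α).ne'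
    field_simp
  have hγpos : 0 < γ := by
    rw [hγ]; have := rpow_pos_of_pos hσ α; positivity
  have hζ1 : Tendsto ζ atTop (nhds 1) := by
    have h1 : Tendsto (fun n : ℕ => (n:ℝ) ^ (-α)) atTop (nhds 0) :=
      (tendsto_rpow_neg_atTop hα).comp tendsto_natCast_atTop_atTop
    have h2 := (h1.mul hζlim).const_sub 1
    rw [zero_mul, sub_zero] at h2
    refine h2.congr' ?_
    filter_upwards [eventually_ge_atTop 1] with n hn
    have hn0 : (0:ℝ) < n := by exact_mod_cast hn
    rw [← mul_assoc, ← rpow_add hn0]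
    simp
  have hg_anti : ∀ n : ℕ, 1 ≤ n → AntitoneOn (fun t : ℝ => renU φ (ζ n) (n * t)) (Ici 0) := by
    intro n hn x hx y hy hxy
    have hn0 : (0:ℝ) ≤ n := Nat.cast_nonneg n
    exact renU_anti h (hζ n hn) (mem_Ici.2 (mul_nonneg hn0 hx)) (mem_Ici.2 (mul_nonneg hn0 hy))
      (mul_le_mul_of_nonneg_left hxy hn0)
  have hg0 : ∀ n : ℕ, 1 ≤ n → ∀ t : ℝ, 0 ≤ t → 0 ≤ renU φ (ζ n) (n * t) := fun n hn t ht =>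
    renU_nonneg h (hζ n hn) (mul_nonneg (Nat.cast_nonneg n) ht)
  have hg1 : ∀ n : ℕ, 1 ≤ n → ∀ t : ℝ, 0 ≤ t → renU φ (ζ n) (n * t) ≤ 1 := fun n hn t ht =>
    renU_le h (hζ n hn) (mul_nonneg (Nat.cast_nonneg n) ht)
  have hlap : ∀ z : ℝ, 0 < z →
      Tendsto (fun n : ℕ => ∫ t in Ioi (0:ℝ), exp (-z * t) * renU φ (ζ n) (n * t)) atTop
        (nhds (z ^ α / (z * (z ^ α - -γ)))) := by
    intro z hz
    have hza := rpow_pos_of_pos hz α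
    have hA := scA_lim hα hα1 hσ h hΦ hΦbar hz
    rw [← hc] at hA
    have hden : 0 < z * (b + 1 * (c * z ^ α)) := by positivity
    have := hA.div ((hζlim.add (hζ1.mul hA)).const_mul z) hden.ne'
    have e : c * z ^ α / (z * (b + 1 * (c * z ^ α))) = z ^ α / (z * (z ^ α - -γ)) := by
      rw [← hγc]
      have : z ^ α - -γ ≠ 0 := by linarith
      have h3 : γ * c + 1 * (c * z ^ α) ≠ 0 := by positivity
      rw [div_eq_div_iff (by positivity) (mul_ne_zero hz.ne' this)]
      ring
    rw [e] at this
    refine this.congr' ?_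
    filter_upwards [eventually_ge_atTop 1] with n hn
    exact ((scG_lap (α := α) h (hζ n hn) hn hz).2).symm
  have hGc : Continuous (fun t : ℝ => mittagLeffler α 1 (-γ * t ^ α)) :=
    (ml_continuous hα).comp (continuous_const.mul (continuous_id.rpow_const (fun _ => Or.inr hα.le)))
  have hz0 : (0:ℝ) < (γ + 1) ^ (1 / α) := rpow_pos_of_pos (by linarith) _
  have hz0a : ((γ + 1) ^ (1 / α)) ^ α = γ + 1 := by
    rw [← rpow_mul (by linarith), one_div_mul_cancel hα.ne', rpow_one]
  obtain ⟨z, hzd⟩ : ∃ z, z = (γ + 1) ^ (1 / α) := ⟨_, rfl⟩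
  rw [← hzd] at hz0 hz0a
  have hyk : ∀ k : ℕ, |(-γ)| < (z + k) ^ α := by
    intro k
    rw [abs_neg, abs_of_pos hγpos]
    have : z ^ α ≤ (z + k) ^ α :=
      rpow_le_rpow hz0.le (by linarith [(Nat.cast_nonneg k : (0:ℝ) ≤ k)]) hα.le
    linarith
  have hpt : ∀ t : ℝ, 0 ≤ t → Tendsto (fun n : ℕ => renU φ (ζ n) (n * t)) atTop
      (nhds (mittagLeffler α 1 (-γ * t ^ α))) := by
    intro t ht
    rcases ht.eq_or_lt with rfl | ht
    · simp only [mul_zero, renU_zero, zero_rpow hα.ne', ml_zero]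
      exact tendsto_const_nhds
    · refine anti_pointwise (g := fun n : ℕ => fun t : ℝ => renU φ (ζ n) (n * t))
        (G := fun t : ℝ => mittagLeffler α 1 (-γ * t ^ α)) hz0 hg_anti hg0 hg1 ?_ hGc ?_ ?_ ht
      · intro n hn
        exact (scG_lap (α := α) h (hζ n hn) hn hz0).1
      · have := hyk 0
        simp only [Nat.cast_zero, add_zero] at this
        exact (ml_lap hα hz0 this).1
      · intro k
        have hzk : 0 < z + k := by positivity
        have := hlap (z + k) hzk
        rw [← (ml_lap hα hzk (hyk k)).2] at this
        exact this
  have hG0 : ∀ t : ℝ, 0 ≤ t → 0 ≤ mittagLeffler α 1 (-γ * t ^ α) := by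
    intro t ht
    refine ge_of_tendsto (hpt t ht) ?_
    filter_upwards [eventually_ge_atTop 1] with n hn using hg0 n hn t ht
  have hGub : ∀ t : ℝ, 0 < t → mittagLeffler α 1 (-γ * t ^ α) ≤ exp 1 / γ * t ^ (-α) := by
    intro t ht
    have hz : 0 < 1 / t := by positivity
    have h1 : t * (exp (-1) * mittagLeffler α 1 (-γ * t ^ α)) ≤
        (1 / t) ^ α / ((1 / t) * ((1 / t) ^ α - -γ)) := by
      refine le_of_tendsto_of_tendsto (((hpt t ht.le).const_mul _).const_mul _) (hlap _ hz) ?_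
      filter_upwards [eventually_ge_atTop 1] with n hn
      exact anti_markov (hg_anti n hn) (hg0 n hn) ht (scG_lap (α := α) h (hζ n hn) hn hz).1
    have hza := rpow_pos_of_pos hz α
    have h2 : (1 / t) ^ α / ((1 / t) * ((1 / t) ^ α - -γ)) ≤ (1 / t) ^ α / ((1 / t) * γ) := by
      apply div_le_div_of_nonneg_left hza.le (by positivity)
      apply mul_le_mul_of_nonneg_left _ hz.le
      linarith
    have h3 : (1 / t) ^ α = t ^ (-α) := by
      rw [one_div, inv_rpow ht.le, rpow_neg ht.le]
    have h4 : t * (exp (-1) * mittagLeffler α 1 (-γ * t ^ α)) ≤ t * (t ^ (-α) / γ) := by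
      refine (h1.trans h2).trans (le_of_eq ?_)
      rw [h3]; field_simp
    have h5 := le_of_mul_le_mul_left h4 ht
    have h6 := mul_le_mul_of_nonneg_left h5 (exp_pos 1).le
    rw [← mul_assoc, ← exp_add] at h6
    simp only [add_neg_cancel, exp_zero, one_mul] at h6
    refine h6.trans (le_of_eq ?_)
    ring
  have hGlim : Tendsto (fun t : ℝ => mittagLeffler α 1 (-γ * t ^ α)) atTop (nhds 0) := by
    have := (tendsto_rpow_neg_atTop hα).const_mul (exp 1 / γ)
    rw [mul_zero] at this
    refine squeeze_zero' ?_ ?_ this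
    · filter_upwards [eventually_ge_atTop 0] with t ht using hG0 t ht
    · filter_upwards [eventually_gt_atTop 0] with t ht using hGub t ht
  exact polya (g := fun n : ℕ => fun t : ℝ => renU φ (ζ n) (n * t)) hg_anti hg0 hGc hpt hGlim


theorem uniform_convergence_of_V0
    (α σ b Vstar0 : ℝ) (hα : α ∈ Set.Ioo (1/2 : ℝ) 1) (hσ : 0 < σ) (hb : 0 < b)
    (hVstar0 : 0 ≤ Vstar0)
    (φ : ℝ → ℝ) (hφ : ∀ t : ℝ, φ t = α * σ * (1 + σ * t) ^ (-(α + 1)))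
    (Φbar : ℝ → ℝ) (hΦbar : ∀ t : ℝ, Φbar t = (1 + σ * t) ^ (-α))
    (ζ : ℕ → ℝ) (hζ : ∀ n : ℕ, 1 ≤ n → ζ n ∈ Set.Ioo (0:ℝ) 1)
    (R : ℕ → ℝ → ℝ) (hR : ∀ n : ℕ, ∀ t : ℝ, R n t = ∑' k : ℕ, ζ n ^ (k + 1) * convPow φ k t)
    (Vn0 : ℕ → ℝ) (hVn0 : ∀ n : ℕ, 1 ≤ n → 0 ≤ Vn0 n)
    (hζlim : Tendsto (fun n : ℕ => (n : ℝ) ^ α * (1 - ζ n)) atTop (nhds b))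
    (hVlim : Tendsto (fun n : ℕ => Vn0 n / (n : ℝ) ^ (2 * α - 1)) atTop (nhds Vstar0))
    (γ : ℝ) (hγ : γ = b * σ ^ α / Real.Gamma (1 - α))
    (V0 : ℕ → ℝ → ℝ)
    (hV0 : ∀ n : ℕ, ∀ t : ℝ,
      V0 n t = (n : ℝ) ^ (1 - 2 * α) * Vn0 n * (Φbar ((n : ℝ) * t) + conv (R n) Φbar ((n : ℝ) * t))) :
    TendstoUniformlyOn (fun n : ℕ => fun t : ℝ => V0 n t)
      (fun t : ℝ => Vstar0 * (1 - mlCDF α γ t)) atTop (Set.Ici 0) := by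
  have hα0 : 0 < α := by linarith [hα.1]
  obtain ⟨h, hΦ⟩ := dens_tail hα0 hσ hφ hΦbar
  have hcore := main_core hα0 hα.2 hσ hb hφ hΦbar hζ hζlim hγ
  rw [Metric.tendstoUniformlyOn_iff] at hcore ⊢
  intro ε hε
  have e1 : 0 < ε / (2 * (Vstar0 + 1)) := by positivity
  filter_upwards [hcore _ e1, eventually_ge_atTop 1,
    Metric.tendsto_nhds.1 hVlim (ε / 2) (by positivity)] with n hn hn1 hV t ht
  have hn0 : (0:ℝ) < n := by exact_mod_cast hn1
  have ht0 : (0:ℝ) ≤ t := ht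
  have hx : (0:ℝ) ≤ n * t := mul_nonneg hn0.le ht0
  have hU : Φbar (n * t) + conv (R n) Φbar (n * t) = renU φ (ζ n) (n * t) :=
    U_formula h hΦ (hζ n hn1) (R n) (hR n) hx
  have hp : (n:ℝ) ^ (1 - 2 * α) * Vn0 n = Vn0 n / (n:ℝ) ^ (2 * α - 1) := by
    have : (1 - 2 * α) = -(2 * α - 1) := by ring
    rw [this, rpow_neg hn0.le]; field_simp
  have hG := hn t ht
  rw [hV0, hU, hp]
  unfold mlCDF
  rw [sub_sub_cancel]
  rw [Real.dist_eq] at *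
  have hu0 := renU_nonneg h (hζ n hn1) hx
  have hu1 := renU_le h (hζ n hn1) hx
  generalize renU φ (ζ n) (n * t) = u at *
  generalize mittagLeffler α 1 (-γ * t ^ α) = G at *
  generalize Vn0 n / (n:ℝ) ^ (2 * α - 1) = c at *
  have k1 : Vstar0 * G - c * u = Vstar0 * (G - u) - (c - Vstar0) * u := by ring
  have k2 : |Vstar0 * (G - u)| ≤ ε / 2 := by
    rw [abs_mul, abs_of_nonneg hVstar0]
    calc Vstar0 * |G - u| ≤ (Vstar0 + 1) * (ε / (2 * (Vstar0 + 1))) :=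
          mul_le_mul (by linarith) hG.le (abs_nonneg _) (by linarith)
      _ = ε / 2 := by field_simp
  have k3 : |(c - Vstar0) * u| < ε / 2 := by
    rw [abs_mul, abs_of_nonneg hu0]
    exact (mul_le_of_le_one_right (abs_nonneg _) hu1).trans_lt hV
  rw [k1]
  calc _ ≤ |Vstar0 * (G - u)| + |(c - Vstar0) * u| := abs_sub _ _
    _ < ε := by linarith
end
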